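/- arXiv:0904.4206 — 3 statements merged into one kernel-verified Lean document; each statement's English description precedes it below -/
import Mathlib

section
/- If a and b are distinct elements of α, then P^{X₁;Y₁}_a and P^{X₂;Y₂}_b are not homotopic for any types (X₁;Y₁), (X₂;Y₂) ∈ {(1,1;l₁,l₂), (3;l), (2,1;l₁,l₂), (1,2;l₁,l₂), (1,1,1;l₁,l₂,l₃)} and any admissible indices (with a ≠ τ(a) required for type (3;l) with letter a, and b ≠ τ(b) for type (3;l) with letter b). -/
namespace Nano

variable {α : Type*}

/-- A letter: an identifier together with its projection to the alphabet `α`. -/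
abbrev Letter (α : Type*) := ℕ × α

/-- The projection of a letter. -/
def proj (A : Letter α) : α := A.2

/-- A phrase: a finite sequence of words, each word a list of letters. -/
abbrev Phrase (α : Type*) := List (List (Letter α))

/-- Flatten a phrase into one list, separating components by `none` (the `|` character). -/
def flat (P : Phrase α) : List (Option (Letter α)) :=
  List.intercalate [none] (P.map fun w => w.map some)

/-- The `i`-th component (word) of a phrase (0-indexed). -/
def comp (P : Phrase α) (i : ℕ) : List (Letter α) := P.getD i []

/-- A phrase is a Gauss phrase if every letter occurring in it occurs exactly twice. -/
def IsGauss [DecidableEq α] (P : Phrase α) : Prop :=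
  ∀ A ∈ P.flatten, P.flatten.count A = 2

/-- All letters of `P` project into the subset `β` of `α`. -/
def ProjIn (β : Set α) (P : Phrase α) : Prop := ∀ A ∈ P.flatten, A.2 ∈ β

/-- Renaming of letters (injective renamings give isomorphisms of `α`-alphabets,
preserving the projection). -/
def rename (f : ℕ → ℕ) (P : Phrase α) : Phrase α :=
  P.map (List.map fun A => (f A.1, A.2))

/-- One elementary step: an isomorphism or one of the homotopy moves (1)-(3),
for the involution `τ` on `α`. -/
inductive Move (τ : α → α) : Phrase α → Phrase α → Prop
  | iso (f : ℕ → ℕ) (hf : Function.Injective f) (P : Phrase α) :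
      Move τ P (rename f P)
  | h1 (P Q : Phrase α) (A : Letter α) (x y : List (Option (Letter α)))
      (hP : flat P = x ++ [some A, some A] ++ y)
      (hQ : flat Q = x ++ y) : Move τ P Q
  | h2 (P Q : Phrase α) (A B : Letter α) (x y z : List (Option (Letter α)))
      (hAB : B.2 = τ A.2)
      (hP : flat P = x ++ [some A, some B] ++ y ++ [some B, some A] ++ z)
      (hQ : flat Q = x ++ y ++ z) : Move τ P Q
  | h3 (P Q : Phrase α) (A B C : Letter α) (x y z t : List (Option (Letter α)))
      (hAB : A.2 = B.2) (hBC : B.2 = C.2)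
      (hP : flat P = x ++ [some A, some B] ++ y ++ [some A, some C] ++ z
              ++ [some B, some C] ++ t)
      (hQ : flat Q = x ++ [some B, some A] ++ y ++ [some C, some A] ++ z
              ++ [some C, some B] ++ t) : Move τ P Q

/-- A nanophrase over the subset `β`: a Gauss phrase all of whose letters project into `β`. -/
def NanoIn [DecidableEq α] (β : Set α) (P : Phrase α) : Prop := IsGauss P ∧ ProjIn β P

/-- Homotopy of nanophrases in the class of nanophrases over `β ⊆ α`:
a finite chain of isomorphisms, moves (1)-(3) and their inverses, all whose
terms are nanophrases over `β`. -/
def HomotopicIn [DecidableEq α] (τ : α → α) (β : Set α) (P Q : Phrase α) : Prop :=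
  Relation.ReflTransGen
    (fun X Y => (Move τ X Y ∨ Move τ Y X) ∧ NanoIn β X ∧ NanoIn β Y) P Q

/-- Homotopy of nanophrases over `α`. -/
def Homotopic [DecidableEq α] (τ : α → α) (P Q : Phrase α) : Prop :=
  HomotopicIn τ Set.univ P Q

/-! ### Desingularization -/

/-- The letter `A_{p,q}` of the desingularized alphabet. -/
def dLetter (A : Letter α) (p q : ℕ) : Letter α := (Nat.pair A.1 (Nat.pair p q), A.2)

/-- The replacement of the `i`-th occurrence (1-indexed) of a letter `A` of
multiplicity `m`: `A_{1,i} A_{2,i} ⋯ A_{i-1,i} A_{i,i+1} ⋯ A_{i,m}`. -/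
def repl (A : Letter α) (i m : ℕ) : List (Letter α) :=
  ((List.range (i - 1)).map fun j => dLetter A (j + 1) i) ++
  ((List.range (m - i)).map fun j => dLetter A i (i + j + 1))

def desingWord [DecidableEq α] (m : Letter α → ℕ) :
    List (Letter α) → (Letter α → ℕ) → List (Letter α)
  | [], _ => []
  | A :: rest, seen =>
      repl A (seen A + 1) (m A) ++
        desingWord m rest (fun B => if B = A then seen B + 1 else seen B)

def desingAux [DecidableEq α] (m : Letter α → ℕ) :
    Phrase α → (Letter α → ℕ) → Phrase α
  | [], _ => []
  | w :: ws, seen => desingWord m w seen :: desingAux m ws (fun B => seen B + w.count B)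

/-- The desingularization `P^d` of an étale phrase `P`. -/
def desing [DecidableEq α] (P : Phrase α) : Phrase α :=
  desingAux (fun A => P.flatten.count A) P (fun _ => 0)

/-- Homotopy of étale phrases: homotopy of their desingularizations. -/
def EHomotopic [DecidableEq α] (τ : α → α) (P Q : Phrase α) : Prop :=
  Homotopic τ (desing P) (desing Q)

/-! ### Phrases over `α` itself, via the identity projection -/

/-- An element of `α` regarded as a letter (identity projection). -/
def ofα (a : α) : Letter α := (0, a)

/-- The empty phrase `(∅)_k` of length `k`. -/
def emptyP (k : ℕ) : Phrase α := List.replicate k []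

/-- `P^{1,1;l₁,l₂}_a`. -/
def P11 (k : ℕ) (l1 l2 : Fin k) (a : α) : Phrase α :=
  List.ofFn fun i => if i = l1 ∨ i = l2 then [ofα a] else []

/-- `P^{3;l}_a`. -/
def P3 (k : ℕ) (l : Fin k) (a : α) : Phrase α :=
  List.ofFn fun i => if i = l then [ofα a, ofα a, ofα a] else []

/-- `P^{2,1;l₁,l₂}_a`. -/
def P21 (k : ℕ) (l1 l2 : Fin k) (a : α) : Phrase α :=
  List.ofFn fun i => if i = l1 then [ofα a, ofα a] else if i = l2 then [ofα a] else []

/-- `P^{1,2;l₁,l₂}_a`. -/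
def P12 (k : ℕ) (l1 l2 : Fin k) (a : α) : Phrase α :=
  List.ofFn fun i => if i = l1 then [ofα a] else if i = l2 then [ofα a, ofα a] else []

/-- `P^{1,1,1;l₁,l₂,l₃}_a`. -/
def P111 (k : ℕ) (l1 l2 l3 : Fin k) (a : α) : Phrase α :=
  List.ofFn fun i => if i = l1 ∨ i = l2 ∨ i = l3 then [ofα a] else []


/-! ### The model phrases, indexed by their type and indices -/

/-- An index for the model phrases `P^{1,1;l₁,l₂}_a`, `P^{3;l}_a`, `P^{2,1;l₁,l₂}_a`,
`P^{1,2;l₁,l₂}_a`, `P^{1,1,1;l₁,l₂,l₃}_a` of length `k`. -/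
inductive Model (k : ℕ) (α : Type*) where
  | m11 (l1 l2 : Fin k) (a : α)
  | m3 (l : Fin k) (a : α)
  | m21 (l1 l2 : Fin k) (a : α)
  | m12 (l1 l2 : Fin k) (a : α)
  | m111 (l1 l2 l3 : Fin k) (a : α)

variable {k : ℕ}

/-- Admissibility: the indices are strictly increasing, and `a ≠ τ(a)` for `P^{3;l}_a`. -/
def Model.valid (τ : α → α) : Model k α → Prop
  | .m11 l1 l2 _ => l1 < l2
  | .m3 _ a => a ≠ τ a
  | .m21 l1 l2 _ => l1 < l2
  | .m12 l1 l2 _ => l1 < l2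
  | .m111 l1 l2 l3 _ => l1 < l2 ∧ l2 < l3

/-- The étale phrase indexed by a model index. -/
def Model.toPhrase : Model k α → Phrase α
  | .m11 l1 l2 a => P11 k l1 l2 a
  | .m3 l a => P3 k l a
  | .m21 l1 l2 a => P21 k l1 l2 a
  | .m12 l1 l2 a => P12 k l1 l2 a
  | .m111 l1 l2 l3 a => P111 k l1 l2 l3 a

/-- The letter of `α` used by a model phrase. -/
def Model.letter : Model k α → α
  | .m11 _ _ a => a
  | .m3 _ a => a
  | .m21 _ _ a => a
  | .m12 _ _ a => a
  | .m111 _ _ _ a => a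

/-! ### Interlacement of letters in a word -/

section Interlacement

variable {β γ R : Type*} [DecidableEq β] [DecidableEq γ] [CommRing R]

/-- The order in which the letters `A` (`true`) and `B` (`false`) occur in the word `w`. -/
def pattern (w : List β) (A B : β) : List Bool :=
  w.filterMap fun D => if D = A then some true else if D = B then some false else none

/-- The interlacement sign of a pattern: `1` for `ABAB`, `-1` for `BABA`, `0` otherwise. -/
def interlacementSign (R : Type*) [CommRing R] (L : List Bool) : R :=
  if L = [true, false, true, false] then 1
  else if L = [false, true, false, true] then -1 else 0

/-- The total weight, with interlacement signs, of the letters interlaced with `A` in `w`. -/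
def interlacementIndex (ε : β → R) (w : List β) (A : β) : R :=
  ∑ B ∈ w.toFinset, ε B * interlacementSign R (pattern w A B)

/-- The order in which the letter `A` (`true`) and the separators (`false`) occur. -/
def separatorPattern (F : List (Option β)) (A : β) : List Bool :=
  F.filterMap fun D => D.elim (some false) fun B => if B = A then some true else none

/-- Whether the first `true` in a list is immediately followed by another `true`. -/
def firstTrueDoubled : List Bool → Bool
  | [] => false
  | false :: L => firstTrueDoubled L
  | true :: L => L.head? = some true

/-- The contribution of a letter: the square of its interlacement index if its two occurrences
lie in the same component, and `1` otherwise. -/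
def contribution (ε : β → R) (F : List (Option β)) (A : β) : R :=
  if firstTrueDoubled (separatorPattern F A) then (interlacementIndex ε F.reduceOption A) ^ 2 else 1

/-- The homotopy invariant: the weighted sum of the contributions of all letters. -/
def phraseInvariant (ε : β → R) (F : List (Option β)) : R :=
  ∑ A ∈ F.reduceOption.toFinset, ε A * contribution ε F A

@[simp] lemma pattern_append (u v : List β) (A B : β) :
    pattern (u ++ v) A B = pattern u A B ++ pattern v A B := by
  simp [pattern]

@[simp] lemma pattern_nil (A B : β) : pattern [] A B = [] := rfl

lemma pattern_cons (D : β) (u : List β) (A B : β) :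
    pattern (D :: u) A B =
      (if D = A then [true] else if D = B then [false] else []) ++ pattern u A B := by
  unfold pattern
  grind

lemma pattern_eq_nil {w : List β} {A B : β} (hA : A ∉ w) (hB : B ∉ w) : pattern w A B = [] := by
  simp only [pattern, List.filterMap_eq_nil_iff]
  grind

lemma pattern_congr_left {w : List β} {A B : β} (hA : A ∉ w) (hB : B ∉ w) (D : β) :
    pattern w A D = pattern w B D :=
  List.filterMap_congr (by grind)

lemma pattern_congr_right {w : List β} {A B : β} (hA : A ∉ w) (hB : B ∉ w) (D : β) :
    pattern w D A = pattern w D B :=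
  List.filterMap_congr (by grind)

lemma pattern_map {f : β → γ} (hf : Function.Injective f) (w : List β) (A B : β) :
    pattern (w.map f) (f A) (f B) = pattern w A B := by
  simp only [pattern, List.filterMap_map, Function.comp_def, hf.eq_iff]

lemma interlacementSign_of_double (L L' : List Bool) (c : Bool) :
    interlacementSign R (L ++ c :: c :: L') = 0 := by
  have h : ∀ d : Bool, L ++ c :: c :: L' ≠ [d, !d, d, !d] := by
    intro d
    rcases L with _ | ⟨_, _ | ⟨_, _ | ⟨_, _ | ⟨_, L⟩⟩⟩⟩ <;>
      cases c <;> cases d <;> simp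
  have h1 := h true
  have h2 := h false
  simp only [Bool.not_true, Bool.not_false] at h1 h2
  simp only [interlacementSign, h1, h2, if_false]

@[simp] lemma separatorPattern_append (u v : List (Option β)) (A : β) :
    separatorPattern (u ++ v) A = separatorPattern u A ++ separatorPattern v A := by
  simp [separatorPattern]

@[simp] lemma separatorPattern_nil (A : β) : separatorPattern [] A = [] := rfl

@[simp] lemma separatorPattern_none_cons (u : List (Option β)) (A : β) :
    separatorPattern (none :: u) A = false :: separatorPattern u A := rfl

lemma separatorPattern_some_cons (D : β) (u : List (Option β)) (A : β) :
    separatorPattern (some D :: u) A =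
      (if D = A then [true] else []) ++ separatorPattern u A := by
  unfold separatorPattern
  split_ifs <;> simp [*]

lemma separatorPattern_congr {F : List (Option β)} {A B : β} (hA : some A ∉ F)
    (hB : some B ∉ F) : separatorPattern F A = separatorPattern F B := by
  refine List.filterMap_congr fun D hD => ?_
  cases D <;> grind

lemma separatorPattern_map {f : β → γ} (hf : Function.Injective f) (F : List (Option β)) (A : β) :
    separatorPattern (F.map (Option.map f)) (f A) = separatorPattern F A := by
  rw [separatorPattern, List.filterMap_map]
  refine List.filterMap_congr fun D _ => ?_
  cases D <;> simp [hf.eq_iff]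

lemma firstTrueDoubled_append {L : List Bool} (h : true ∉ L) (L' : List Bool) :
    firstTrueDoubled (L ++ L') = firstTrueDoubled L' := by
  induction L with
  | nil => rfl
  | cons c L ih => cases c <;> simp_all [firstTrueDoubled]

lemma true_notMem_separatorPattern {F : List (Option β)} {A : β} (hA : some A ∉ F) :
    true ∉ separatorPattern F A := by
  simp only [separatorPattern, List.mem_filterMap, not_exists, not_and]
  intro D hD
  cases D <;> grind

/-! ### Invariance under the moves -/

lemma phraseInvariant_map {f : β → γ} (hf : Function.Injective f) (ε : γ → R)
    (F : List (Option β)) :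
    phraseInvariant ε (F.map (Option.map f)) = phraseInvariant (ε ∘ f) F := by
  have hr : (F.map (Option.map f)).reduceOption = F.reduceOption.map f := by
    rw [List.reduceOption_map]
  have hs : ∀ w : List β, (w.map f).toFinset = w.toFinset.map ⟨f, hf⟩ := by
    intro w; ext; simp
  simp only [phraseInvariant, contribution, interlacementIndex, hr, hs, Finset.sum_map,
    Function.Embedding.coeFn_mk, pattern_map hf, separatorPattern_map hf, Function.comp_apply]

lemma phraseInvariant_remove_double (ε : β → R) (x y : List (Option β)) (A : β)
    (hx : some A ∉ x) (hy : some A ∉ y) :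
    phraseInvariant ε (x ++ [some A, some A] ++ y) = phraseInvariant ε (x ++ y) := by
  have hu : A ∉ x.reduceOption := by rwa [List.reduceOption_mem_iff]
  have hv : A ∉ y.reduceOption := by rwa [List.reduceOption_mem_iff]
  have hlet : (x ++ [some A, some A] ++ y).reduceOption =
      x.reduceOption ++ [A, A] ++ y.reduceOption := by
    simp [List.reduceOption_append]
  have hset : (x.reduceOption ++ [A, A] ++ y.reduceOption).toFinset =
      insert A (x.reduceOption ++ y.reduceOption).toFinset := by
    ext; simp
  have hnot : A ∉ (x.reduceOption ++ y.reduceOption).toFinset := by simp [hu, hv]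
  have hidx : ∀ D ∈ (x.reduceOption ++ y.reduceOption).toFinset,
      interlacementIndex ε (x.reduceOption ++ [A, A] ++ y.reduceOption) D =
        interlacementIndex ε (x.reduceOption ++ y.reduceOption) D := by
    intro D hD
    have hDA : A ≠ D := fun h => hnot (h ▸ hD)
    rw [interlacementIndex, hset, Finset.sum_insert hnot, interlacementIndex]
    have h0 : interlacementSign R
        (pattern (x.reduceOption ++ [A, A] ++ y.reduceOption) D A) = 0 := by
      simp [pattern_cons, hDA, interlacementSign_of_double]
    rw [h0, mul_zero, zero_add]
    refine Finset.sum_congr rfl fun E hE => ?_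
    have hEA : A ≠ E := fun h => hnot (h ▸ hE)
    simp [pattern_cons, hDA, hEA]
  have hA : contribution ε (x ++ [some A, some A] ++ y) A = 0 := by
    have h0 : interlacementIndex ε (x.reduceOption ++ [A, A] ++ y.reduceOption) A = 0 :=
      Finset.sum_eq_zero fun D _ => by simp [pattern_cons, interlacementSign_of_double]
    rw [contribution, hlet, h0]
    simp [separatorPattern_some_cons, firstTrueDoubled_append (true_notMem_separatorPattern hx),
      firstTrueDoubled]
  rw [phraseInvariant, hlet, hset, Finset.sum_insert hnot, hA, mul_zero, zero_add, phraseInvariant,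
    List.reduceOption_append]
  refine Finset.sum_congr rfl fun D hD => ?_
  have hDA : A ≠ D := fun h => hnot (h ▸ hD)
  rw [contribution, hlet, hidx D hD, contribution, List.reduceOption_append]
  simp [separatorPattern_some_cons, hDA]

lemma phraseInvariant_remove_pair (ε : β → R) (x y z : List (Option β)) (A B : β)
    (hε : ε B = -ε A) (hAB : A ≠ B)
    (hAx : some A ∉ x) (hAy : some A ∉ y) (hAz : some A ∉ z)
    (hBx : some B ∉ x) (hBy : some B ∉ y) (hBz : some B ∉ z) :
    phraseInvariant ε (x ++ [some A, some B] ++ y ++ [some B, some A] ++ z) =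
      phraseInvariant ε (x ++ y ++ z) := by
  have hlet : (x ++ [some A, some B] ++ y ++ [some B, some A] ++ z).reduceOption =
      x.reduceOption ++ [A, B] ++ y.reduceOption ++ [B, A] ++ z.reduceOption := by
    simp [List.reduceOption_append]
  have hlet' : (x ++ y ++ z).reduceOption =
      x.reduceOption ++ y.reduceOption ++ z.reduceOption := by
    simp [List.reduceOption_append]
  have hsA := separatorPattern_congr hAx hBx
  have hsB := separatorPattern_congr hAy hBy
  have hsC := separatorPattern_congr hAz hBz
  rw [← List.reduceOption_mem_iff] at hAx hAy hAz hBx hBy hBz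
  unfold phraseInvariant contribution
  rw [hlet, hlet']
  generalize x.reduceOption = u at *
  generalize y.reduceOption = v at *
  generalize z.reduceOption = w at *
  have hset : (u ++ [A, B] ++ v ++ [B, A] ++ w).toFinset =
      insert A (insert B (u ++ v ++ w).toFinset) := by
    ext; simp [or_comm, or_left_comm]
  have hB : B ∉ (u ++ v ++ w).toFinset := by simp [*]
  have hA' : A ∉ (u ++ v ++ w).toFinset := by simp [*]
  have hA : A ∉ insert B (u ++ v ++ w).toFinset := by simp [*]
  have hidx : ∀ D ∈ (u ++ v ++ w).toFinset,
      interlacementIndex ε (u ++ [A, B] ++ v ++ [B, A] ++ w) D =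
        interlacementIndex ε (u ++ v ++ w) D := by
    intro D hD
    have hDA : A ≠ D := fun h => hA' (h ▸ hD)
    have hDB : B ≠ D := fun h => hB (h ▸ hD)
    rw [interlacementIndex, hset, Finset.sum_insert hA, Finset.sum_insert hB, interlacementIndex]
    have h0 : pattern (u ++ [A, B] ++ v ++ [B, A] ++ w) D A =
        pattern (u ++ [A, B] ++ v ++ [B, A] ++ w) D B := by
      simp [pattern_cons, hDA, hDB, hAB, hAB.symm, pattern_congr_right hAx hBx,
        pattern_congr_right hAy hBy, pattern_congr_right hAz hBz]
    rw [h0, hε, neg_mul, add_neg_cancel_left]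
    refine Finset.sum_congr rfl fun E hE => ?_
    have hEA : A ≠ E := fun h => hA' (h ▸ hE)
    have hEB : B ≠ E := fun h => hB (h ▸ hE)
    simp [pattern_cons, hDA, hDB, hEA, hEB]
  have hAB' : interlacementIndex ε (u ++ [A, B] ++ v ++ [B, A] ++ w) A =
      interlacementIndex ε (u ++ [A, B] ++ v ++ [B, A] ++ w) B := by
    rw [interlacementIndex, interlacementIndex, hset, Finset.sum_insert hA, Finset.sum_insert hB,
      Finset.sum_insert hA, Finset.sum_insert hB]
    congr 1
    · simp [pattern_cons, hAB.symm, pattern_eq_nil, *, interlacementSign]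
    congr 1
    · simp [pattern_cons, hAB.symm, pattern_eq_nil, *, interlacementSign]
    refine Finset.sum_congr rfl fun E hE => ?_
    have hEA : A ≠ E := fun h => hA' (h ▸ hE)
    have hEB : B ≠ E := fun h => hB (h ▸ hE)
    simp [pattern_cons, hEA, hEB, hAB, hAB.symm, pattern_congr_left hAx hBx,
        pattern_congr_left hAy hBy, pattern_congr_left hAz hBz]
  have hsep : separatorPattern (x ++ [some A, some B] ++ y ++ [some B, some A] ++ z) A =
      separatorPattern (x ++ [some A, some B] ++ y ++ [some B, some A] ++ z) B := by
    simp [separatorPattern_some_cons, hAB, hAB.symm, hsA, hsB, hsC]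
  rw [hset, Finset.sum_insert hA, Finset.sum_insert hB, hAB', hsep, hε, neg_mul,
    add_neg_cancel_left]
  refine Finset.sum_congr rfl fun D hD => ?_
  have hDA : A ≠ D := fun h => hA' (h ▸ hD)
  have hDB : B ≠ D := fun h => hB (h ▸ hD)
  rw [hidx D hD]
  simp [separatorPattern_some_cons, hDA, hDB]

lemma phraseInvariant_exchange (ε : β → R) (x y z t : List (Option β)) (A B C : β)
    (hεAB : ε A = ε B) (hεBC : ε B = ε C) (hAB : A ≠ B) (hAC : A ≠ C) (hBC : B ≠ C)
    (hA : some A ∉ x ++ y ++ z ++ t) (hB : some B ∉ x ++ y ++ z ++ t)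
    (hC : some C ∉ x ++ y ++ z ++ t) :
    phraseInvariant ε (x ++ [some A, some B] ++ y ++ [some A, some C] ++ z
        ++ [some B, some C] ++ t) =
      phraseInvariant ε (x ++ [some B, some A] ++ y ++ [some C, some A] ++ z
        ++ [some C, some B] ++ t) := by
  have hlet : (x ++ [some A, some B] ++ y ++ [some A, some C] ++ z
        ++ [some B, some C] ++ t).reduceOption =
      x.reduceOption ++ [A, B] ++ y.reduceOption ++ [A, C] ++ z.reduceOption ++ [B, C]
        ++ t.reduceOption := by
    simp [List.reduceOption_append]
  have hlet' : (x ++ [some B, some A] ++ y ++ [some C, some A] ++ z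
        ++ [some C, some B] ++ t).reduceOption =
      x.reduceOption ++ [B, A] ++ y.reduceOption ++ [C, A] ++ z.reduceOption ++ [C, B]
        ++ t.reduceOption := by
    simp [List.reduceOption_append]
  have hsep : ∀ D, separatorPattern (x ++ [some A, some B] ++ y ++ [some A, some C] ++ z
        ++ [some B, some C] ++ t) D = separatorPattern (x ++ [some B, some A] ++ y ++
        [some C, some A] ++ z ++ [some C, some B] ++ t) D := by
    intro D
    by_cases h1 : A = D
    · subst h1; simp [separatorPattern_some_cons, hAB.symm, hAC.symm]
    by_cases h2 : B = D
    · subst h2; simp [separatorPattern_some_cons, hAB, hBC.symm]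
    simp [separatorPattern_some_cons, h1, h2]
  simp only [List.mem_append, ← List.reduceOption_mem_iff, not_or] at hA hB hC
  unfold phraseInvariant contribution
  simp only [hlet, hlet', hsep]
  generalize x.reduceOption = u at *
  generalize y.reduceOption = v at *
  generalize z.reduceOption = w at *
  generalize t.reduceOption = s at *
  obtain ⟨⟨⟨hA1, hA2⟩, hA3⟩, hA4⟩ := hA
  obtain ⟨⟨⟨hB1, hB2⟩, hB3⟩, hB4⟩ := hB
  obtain ⟨⟨⟨hC1, hC2⟩, hC3⟩, hC4⟩ := hC
  have hset : (u ++ [A, B] ++ v ++ [A, C] ++ w ++ [B, C] ++ s).toFinset =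
      insert A (insert B (insert C (u ++ v ++ w ++ s).toFinset)) := by
    ext; simp [or_comm]
  have hset' : (u ++ [B, A] ++ v ++ [C, A] ++ w ++ [C, B] ++ s).toFinset =
      insert A (insert B (insert C (u ++ v ++ w ++ s).toFinset)) := by
    ext; simp [or_comm, or_left_comm]
  have hC' : C ∉ (u ++ v ++ w ++ s).toFinset := by simp [*]
  have hB' : B ∉ insert C (u ++ v ++ w ++ s).toFinset := by simp [*]
  have hA' : A ∉ insert B (insert C (u ++ v ++ w ++ s).toFinset) := by simp [*]
  have hidx : ∀ D, interlacementIndex ε (u ++ [A, B] ++ v ++ [A, C] ++ w ++ [B, C] ++ s) D =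
      interlacementIndex ε (u ++ [B, A] ++ v ++ [C, A] ++ w ++ [C, B] ++ s) D := by
    intro D
    rw [interlacementIndex, interlacementIndex, hset, hset', Finset.sum_insert hA',
      Finset.sum_insert hB', Finset.sum_insert hC', Finset.sum_insert hA',
      Finset.sum_insert hB', Finset.sum_insert hC', ← add_assoc, ← add_assoc, ← add_assoc,
      ← add_assoc]
    have hout : ∀ E ∈ (u ++ v ++ w ++ s).toFinset, A ≠ E ∧ B ≠ E ∧ C ≠ E := by
      rintro E hE
      refine ⟨?_, ?_, ?_⟩ <;> rintro rfl <;> simp_all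
    congr 1
    · by_cases h1 : A = D
      · subst h1
        simp [pattern_cons, hAB.symm, hAC.symm, hBC.symm, pattern_eq_nil, *,
          interlacementSign]
      by_cases h2 : B = D
      · subst h2
        simp [pattern_cons, hAC.symm, hBC.symm, pattern_eq_nil, *,
          interlacementSign]
      by_cases h3 : C = D
      · subst h3
        simp [pattern_cons, hAB.symm, hBC.symm, pattern_eq_nil, *,
          interlacementSign]
      simp [pattern_cons, h1, h2, h3, hAB, hAC, hBC, hAB.symm, hAC.symm, hBC.symm]
    · refine Finset.sum_congr rfl fun E hE => ?_
      obtain ⟨hEA, hEB, hEC⟩ := hout E hE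
      by_cases h1 : A = D
      · subst h1
        simp [pattern_cons, hAB.symm, hAC.symm, hEB, hEC]
      by_cases h2 : B = D
      · subst h2
        simp [pattern_cons, hAB, hBC.symm, hEA, hEC]
      simp [pattern_cons, h1, h2, hEA, hEB, hEC]
  rw [hset, hset']
  exact Finset.sum_congr rfl fun D _ => by rw [hidx]

/-! ### Values on words with one or three letters -/

@[simp] lemma phraseInvariant_none_cons (ε : β → R) (F : List (Option β)) :
    phraseInvariant ε (none :: F) = phraseInvariant ε F := by
  simp [phraseInvariant, contribution, List.reduceOption_cons_of_none, firstTrueDoubled]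

lemma phraseInvariant_of_double (ε : β → R) {F : List (Option β)} {A : β}
    (hF : F.reduceOption = [A, A]) (hA : firstTrueDoubled (separatorPattern F A) = false) :
    phraseInvariant ε F = ε A := by
  simp [phraseInvariant, contribution, hF, hA]

lemma phraseInvariant_of_triple (ε : β → R) {F : List (Option β)} {A B C : β}
    (hAB : A ≠ B) (hAC : A ≠ C) (hBC : B ≠ C) (hF : F.reduceOption = [A, B, A, C, B, C])
    (hεAB : ε A = ε B) (hεBC : ε B = ε C) :
    phraseInvariant ε F =
      ε C * (if firstTrueDoubled (separatorPattern F A) then ε C ^ 2 else 1) +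
      ε C * (if firstTrueDoubled (separatorPattern F B) then 0 else 1) +
      ε C * (if firstTrueDoubled (separatorPattern F C) then ε C ^ 2 else 1) := by
  have hset : [A, B, A, C, B, C].toFinset = {A, B, C} := by ext; simp [or_comm]
  have hA : A ∉ ({B, C} : Finset β) := by simp [*]
  have hB : B ∉ ({C} : Finset β) := by simp [*]
  simp [phraseInvariant, contribution, hF, interlacementIndex, hset, Finset.sum_insert hA,
    Finset.sum_insert hB, pattern_cons, hAB, hAC, hBC, hAB.symm, hAC.symm, hBC.symm,
    interlacementSign, hεAB, hεBC, add_assoc]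

@[simp] lemma separatorPattern_replicate_none (n : ℕ) (A : β) :
    separatorPattern (List.replicate n none) A = List.replicate n false := by
  induction n with
  | zero => rfl
  | succ n ih => simp [List.replicate_succ, ih]

@[simp] lemma firstTrueDoubled_replicate_false_append (n : ℕ) (L : List Bool) :
    firstTrueDoubled (List.replicate n false ++ L) = firstTrueDoubled L :=
  firstTrueDoubled_append (by simp) L

end Interlacement

/-! ### Homotopy invariance -/

section Homotopy

variable {R : Type*} [CommRing R]

lemma flat_cons (w : List (Letter α)) (P : Phrase α) :
    flat (w :: P) = w.map some ++ P.flatMap fun v => none :: v.map some := by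
  induction P generalizing w with
  | nil => simp [flat, List.intercalate]
  | cons v P ih =>
    have h : flat (w :: v :: P) = w.map some ++ none :: flat (v :: P) := by
      simp [flat, List.intercalate]
    rw [h, ih]
    simp

lemma reduceOption_flatMap (P : Phrase α) :
    (P.flatMap fun v => none :: v.map some).reduceOption = P.flatten := by
  induction P with
  | nil => rfl
  | cons w P ih =>
    have h : (w.map some).reduceOption = w := by
      simp [List.reduceOption]
    simp [List.reduceOption_append, List.reduceOption_cons_of_none, h, ih]

@[simp] lemma flatMap_replicate_nil (n : ℕ) :
    ((List.replicate n []).flatMap fun v : List (Letter α) => none :: v.map some) =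
      List.replicate n none := by
  induction n with
  | zero => rfl
  | succ n ih => simp [List.replicate_succ, ih]

lemma reduceOption_flat (P : Phrase α) : (flat P).reduceOption = P.flatten := by
  cases P with
  | nil => rfl
  | cons w P =>
    rw [flat_cons, ← reduceOption_flatMap]
    simp [List.reduceOption_append, List.reduceOption_cons_of_none]

lemma flat_rename (f : ℕ → ℕ) (P : Phrase α) :
    flat (rename f P) = (flat P).map (Option.map fun A => (f A.1, A.2)) := by
  cases P with
  | nil => rfl
  | cons w P =>
    simp [rename, flat_cons, List.flatMap_map, List.map_flatMap, Function.comp_def]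

variable [DecidableEq α]

lemma phraseInvariant_flat (ε : Letter α → R) (P : Phrase α) :
    phraseInvariant ε (flat P) = phraseInvariant ε (P.flatMap fun v => none :: v.map some) := by
  cases P with
  | nil => rfl
  | cons w P => simp [flat_cons]

lemma IsGauss.count_reduceOption {P : Phrase α} (h : IsGauss P) {A : Letter α}
    (hA : A ∈ (flat P).reduceOption) : (flat P).reduceOption.count A = 2 := by
  rw [reduceOption_flat] at hA ⊢
  exact h A hA

variable {τ : α → α} {ε : α → R}

lemma Move.phraseInvariant_eq (hε : ∀ a, ε (τ a) = -ε a) {P Q : Phrase α} (h : Move τ P Q)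
    (hG : IsGauss P) :
    phraseInvariant (fun A : Letter α => ε A.2) (flat P) =
      phraseInvariant (fun A : Letter α => ε A.2) (flat Q) := by
  cases h with
  | iso f hf =>
    have hinj : Function.Injective fun A : Letter α => (f A.1, A.2) := by
      rintro ⟨i, a⟩ ⟨j, b⟩ h
      simp_all [hf.eq_iff]
    rw [flat_rename, phraseInvariant_map hinj]
    rfl
  | h1 _ _ A x y hP hQ =>
    have hA := hG.count_reduceOption (A := A) (by simp [hP, List.reduceOption_append])
    simp only [hP, List.reduceOption_append, List.count_append, List.reduceOption_cons_of_some,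
      List.reduceOption_nil, List.count_cons_self, List.count_nil] at hA
    rw [hP, hQ]
    refine phraseInvariant_remove_double _ _ _ _ ?_ ?_ <;>
      rw [← List.reduceOption_mem_iff, ← List.count_eq_zero] <;> omega
  | h2 _ _ A B x y z hAB hP hQ =>
    have hA := hG.count_reduceOption (A := A) (by simp [hP, List.reduceOption_append])
    have hB := hG.count_reduceOption (A := B) (by simp [hP, List.reduceOption_append])
    simp only [hP, List.reduceOption_append, List.count_append, List.reduceOption_cons_of_some,
      List.reduceOption_nil, List.count_cons, List.count_nil, beq_iff_eq] at hA hB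
    have hne : A ≠ B := by rintro rfl; simp at hA; omega
    simp only [hne, hne.symm, if_true, if_false] at hA hB
    rw [hP, hQ]
    refine phraseInvariant_remove_pair _ _ _ _ _ _ (by simp [hAB, hε]) hne ?_ ?_ ?_ ?_ ?_ ?_ <;>
      rw [← List.reduceOption_mem_iff, ← List.count_eq_zero] <;> omega
  | h3 _ _ A B C x y z t hAB hBC hP hQ =>
    have hA := hG.count_reduceOption (A := A) (by simp [hP, List.reduceOption_append])
    have hB := hG.count_reduceOption (A := B) (by simp [hP, List.reduceOption_append])
    have hC := hG.count_reduceOption (A := C) (by simp [hP, List.reduceOption_append])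
    simp only [hP, List.reduceOption_append, List.count_append, List.reduceOption_cons_of_some,
      List.reduceOption_nil, List.count_cons, List.count_nil, beq_iff_eq] at hA hB hC
    have hne : A ≠ B := by rintro rfl; simp at hA; omega
    have hne' : A ≠ C := by rintro rfl; simp at hA; omega
    have hne'' : B ≠ C := by rintro rfl; simp at hB; omega
    simp only [hne, hne.symm, hne', hne'.symm, hne'', hne''.symm, if_true, if_false] at hA hB hC
    rw [hP, hQ]
    refine phraseInvariant_exchange _ _ _ _ _ _ _ _ (by simp [hAB]) (by simp [hBC]) hne hne' hne''
      ?_ ?_ ?_ <;>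
      rw [← List.reduceOption_mem_iff, ← List.count_eq_zero] <;>
      simp only [List.reduceOption_append, List.count_append] <;> omega

lemma Homotopic.phraseInvariant_eq (hε : ∀ a, ε (τ a) = -ε a) {P Q : Phrase α}
    (h : Homotopic τ P Q) :
    phraseInvariant (fun A : Letter α => ε A.2) (flat P) =
      phraseInvariant (fun A : Letter α => ε A.2) (flat Q) := by
  induction h with
  | refl => rfl
  | tail _ hstep ih =>
    obtain ⟨hmove | hmove, hX, hY⟩ := hstep
    · exact ih.trans (hmove.phraseInvariant_eq hε hX.1)
    · exact ih.trans (hmove.phraseInvariant_eq hε hY.1).symm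

end Homotopy

/-! ### The model phrases -/

section Models

lemma ofFn_one {β : Type*} (l : Fin k) (f : Fin k → List β) (hf : ∀ i, i ≠ l → f i = []) :
    List.ofFn f = List.replicate l [] ++ f l :: List.replicate (k - l - 1) [] := by
  apply List.ext_getElem
  · simp; omega
  · intro i h₁ h₂
    simp only [List.length_ofFn] at h₁
    have := hf ⟨i, h₁⟩
    simp only [ne_eq, Fin.ext_iff] at this
    grind

lemma ofFn_two {β : Type*} {l₁ l₂ : Fin k} (h : l₁ < l₂) (f : Fin k → List β)
    (hf : ∀ i, i ≠ l₁ → i ≠ l₂ → f i = []) :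
    List.ofFn f = List.replicate l₁ [] ++ f l₁ :: (List.replicate (l₂ - l₁ - 1) [] ++
      f l₂ :: List.replicate (k - l₂ - 1) []) := by
  rw [Fin.lt_def] at h
  apply List.ext_getElem
  · simp; omega
  · intro i h₁ h₂
    simp only [List.length_ofFn] at h₁
    have := hf ⟨i, h₁⟩
    simp only [ne_eq, Fin.ext_iff] at this
    grind

lemma ofFn_three {β : Type*} {l₁ l₂ l₃ : Fin k} (h : l₁ < l₂) (h' : l₂ < l₃)
    (f : Fin k → List β) (hf : ∀ i, i ≠ l₁ → i ≠ l₂ → i ≠ l₃ → f i = []) :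
    List.ofFn f = List.replicate l₁ [] ++ f l₁ :: (List.replicate (l₂ - l₁ - 1) [] ++
      f l₂ :: (List.replicate (l₃ - l₂ - 1) [] ++ f l₃ :: List.replicate (k - l₃ - 1) [])) := by
  rw [Fin.lt_def] at h h'
  apply List.ext_getElem
  · simp; omega
  · intro i h₁ h₂
    simp only [List.length_ofFn] at h₁
    have := hf ⟨i, h₁⟩
    simp only [ne_eq, Fin.ext_iff] at this
    grind

lemma dLetter_eq_iff {A : Letter α} {p q p' q' : ℕ} :
    dLetter A p q = dLetter A p' q' ↔ p = p' ∧ q = q' := by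
  simp [dLetter]

variable [DecidableEq α] {R : Type*} [CommRing R]

@[simp] lemma desingAux_replicate_nil_append (m : Letter α → ℕ) (n : ℕ) (P : Phrase α)
    (seen : Letter α → ℕ) :
    desingAux m (List.replicate n [] ++ P) seen = List.replicate n [] ++ desingAux m P seen := by
  induction n with
  | zero => rfl
  | succ n ih => simpa [List.replicate_succ, desingAux, desingWord] using ih

@[simp] lemma desingAux_replicate_nil (m : Letter α → ℕ) (n : ℕ) (seen : Letter α → ℕ) :
    desingAux m (List.replicate n []) seen = List.replicate n [] := by
  simpa [desingAux] using desingAux_replicate_nil_append m n [] seen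

lemma desing_P11 {l₁ l₂ : Fin k} (h : l₁ < l₂) (a : α) :
    desing (P11 k l₁ l₂ a) =
      List.replicate l₁ [] ++ [dLetter (ofα a) 1 2] :: (List.replicate (l₂ - l₁ - 1) [] ++
        [dLetter (ofα a) 1 2] :: List.replicate (k - l₂ - 1) []) := by
  rw [P11, ofFn_two h _ (by simp_all)]
  simp [desing, desingAux, desingWord, repl]

lemma desing_P3 (l : Fin k) (a : α) :
    desing (P3 k l a) =
      List.replicate l [] ++ [dLetter (ofα a) 1 2, dLetter (ofα a) 1 3, dLetter (ofα a) 1 2,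
        dLetter (ofα a) 2 3, dLetter (ofα a) 1 3, dLetter (ofα a) 2 3] ::
          List.replicate (k - l - 1) [] := by
  rw [P3, ofFn_one l _ (by simp_all)]
  simp [desing, desingAux, desingWord, repl, List.range_succ]

lemma desing_P21 {l₁ l₂ : Fin k} (h : l₁ < l₂) (a : α) :
    desing (P21 k l₁ l₂ a) =
      List.replicate l₁ [] ++ [dLetter (ofα a) 1 2, dLetter (ofα a) 1 3, dLetter (ofα a) 1 2,
        dLetter (ofα a) 2 3] :: (List.replicate (l₂ - l₁ - 1) [] ++
        [dLetter (ofα a) 1 3, dLetter (ofα a) 2 3] :: List.replicate (k - l₂ - 1) []) := by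
  rw [P21, ofFn_two h _ (by simp_all)]
  simp [desing, desingAux, desingWord, repl, List.range_succ, h.ne']

lemma desing_P12 {l₁ l₂ : Fin k} (h : l₁ < l₂) (a : α) :
    desing (P12 k l₁ l₂ a) =
      List.replicate l₁ [] ++ [dLetter (ofα a) 1 2, dLetter (ofα a) 1 3] ::
        (List.replicate (l₂ - l₁ - 1) [] ++ [dLetter (ofα a) 1 2, dLetter (ofα a) 2 3,
          dLetter (ofα a) 1 3, dLetter (ofα a) 2 3] :: List.replicate (k - l₂ - 1) []) := by
  rw [P12, ofFn_two h _ (by simp_all)]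
  simp [desing, desingAux, desingWord, repl, List.range_succ, h.ne']

lemma desing_P111 {l₁ l₂ l₃ : Fin k} (h : l₁ < l₂) (h' : l₂ < l₃) (a : α) :
    desing (P111 k l₁ l₂ l₃ a) =
      List.replicate l₁ [] ++ [dLetter (ofα a) 1 2, dLetter (ofα a) 1 3] ::
        (List.replicate (l₂ - l₁ - 1) [] ++ [dLetter (ofα a) 1 2, dLetter (ofα a) 2 3] ::
          (List.replicate (l₃ - l₂ - 1) [] ++ [dLetter (ofα a) 1 3, dLetter (ofα a) 2 3] ::
            List.replicate (k - l₃ - 1) [])) := by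
  rw [P111, ofFn_three h h' _ (by simp_all)]
  simp [desing, desingAux, desingWord, repl, List.range_succ]

/-- The coefficient of the weight of the letter in the invariant of a model phrase. -/
def Model.coefficient (r : R) : Model k α → R
  | .m11 _ _ _ => 1
  | .m3 _ _ => 2 * r ^ 2
  | .m21 _ _ _ => r ^ 2 + 2
  | .m12 _ _ _ => r ^ 2 + 2
  | .m111 _ _ _ _ => 3

lemma phraseInvariant_flat_of_triple (ε : α → R) (a : α) (P : Phrase α)
    (hP : P.flatten = [dLetter (ofα a) 1 2, dLetter (ofα a) 1 3, dLetter (ofα a) 1 2,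
      dLetter (ofα a) 2 3, dLetter (ofα a) 1 3, dLetter (ofα a) 2 3])
    (F : List (Option (Letter α))) (hF : F = P.flatMap fun v => none :: v.map some) :
    phraseInvariant (fun A : Letter α => ε A.2) (flat P) =
      ε a * (if firstTrueDoubled (separatorPattern F (dLetter (ofα a) 1 2)) then ε a ^ 2 else 1) +
      ε a * (if firstTrueDoubled (separatorPattern F (dLetter (ofα a) 1 3)) then 0 else 1) +
      ε a * (if firstTrueDoubled (separatorPattern F (dLetter (ofα a) 2 3))
        then ε a ^ 2 else 1) := by
  rw [phraseInvariant_flat, ← hF]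
  subst hF
  exact phraseInvariant_of_triple _ (A := dLetter (ofα a) 1 2) (B := dLetter (ofα a) 1 3)
    (C := dLetter (ofα a) 2 3) (by simp [dLetter_eq_iff]) (by simp [dLetter_eq_iff])
    (by simp [dLetter_eq_iff]) (by rw [reduceOption_flatMap, hP]) rfl rfl

@[simp] lemma getD_head_replicate_false (n : ℕ) :
    (List.replicate n false).head?.getD false = false := by
  cases n <;> simp [List.replicate_succ]

lemma Model.phraseInvariant_eq {τ : α → α} (ε : α → R) (M : Model k α) (hM : M.valid τ) :
    phraseInvariant (fun A : Letter α => ε A.2) (flat (desing M.toPhrase)) =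
      ε M.letter * M.coefficient (ε M.letter) := by
  cases M with
  | m11 l₁ l₂ a =>
    simp only [Model.toPhrase, desing_P11 (show l₁ < l₂ from hM)]
    rw [phraseInvariant_flat, phraseInvariant_of_double (A := dLetter (ofα a) 1 2)]
    · simp [Model.letter, Model.coefficient, dLetter, ofα]
    · rw [reduceOption_flatMap]
      simp
    · simp [separatorPattern_some_cons, firstTrueDoubled]
  | m3 l a =>
    simp only [Model.toPhrase, desing_P3]
    rw [phraseInvariant_flat_of_triple ε a _ (by simp) _ rfl]
    simp [separatorPattern_some_cons, dLetter_eq_iff, firstTrueDoubled, Model.letter,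
      Model.coefficient]
    ring
  | m21 l₁ l₂ a =>
    simp only [Model.toPhrase, desing_P21 (show l₁ < l₂ from hM)]
    rw [phraseInvariant_flat_of_triple ε a _ (by simp) _ rfl]
    simp [separatorPattern_some_cons, dLetter_eq_iff, firstTrueDoubled, Model.letter,
      Model.coefficient]
    ring
  | m12 l₁ l₂ a =>
    simp only [Model.toPhrase, desing_P12 (show l₁ < l₂ from hM)]
    rw [phraseInvariant_flat_of_triple ε a _ (by simp) _ rfl]
    simp [separatorPattern_some_cons, dLetter_eq_iff, firstTrueDoubled, Model.letter,
      Model.coefficient]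
    ring
  | m111 l₁ l₂ l₃ a =>
    simp only [Model.toPhrase, desing_P111 (show l₁ < l₂ from hM.1) (show l₂ < l₃ from hM.2)]
    rw [phraseInvariant_flat_of_triple ε a _ (by simp) _ rfl]
    simp [separatorPattern_some_cons, dLetter_eq_iff, firstTrueDoubled, Model.letter,
      Model.coefficient]
    ring

end Models

/-- **Lemma 4.6** of the paper: if `a` and `b` are distinct elements of `α`,
then `P^{X₁;Y₁}_a` and `P^{X₂;Y₂}_b` are not homotopic, for any admissible
types and indices. -/
theorem model_phrases_with_distinct_letters_not_homotopic
    {α : Type*} [Fintype α] [DecidableEq α] (τ : α → α) (hτ : Function.Involutive τ)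
    (k : ℕ) (a b : α) (hab : a ≠ b)
    (M N : Model k α) (hM : M.valid τ) (hN : N.valid τ)
    (hMa : M.letter = a) (hNb : N.letter = b) :
    ¬ EHomotopic τ M.toPhrase N.toPhrase := by
  intro h
  subst hMa hNb
  have key {R : Type} [CommRing R] (ε : α → R) (hε : ∀ x, ε (τ x) = -ε x) :
      ε M.letter * M.coefficient (ε M.letter) = ε N.letter * N.coefficient (ε N.letter) := by
    rw [← M.phraseInvariant_eq ε hM, ← N.phraseInvariant_eq ε hN]
    exact Homotopic.phraseInvariant_eq hε h
  by_cases hfix : τ M.letter = M.letter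
  · have hM1 : M.coefficient (1 : ZMod 2) = 1 := by
      cases M with
      | m3 l a => exact absurd hfix.symm hM
      | _ => rfl
    have := key (fun x => if x = M.letter then (1 : ZMod 2) else 0) fun x => by
      simp [ZMod.neg_eq_self_mod_two, hτ.eq_iff, hfix]
    simp [hab.symm, hM1] at this
  · have hpos (K : Model k α) : 0 < K.coefficient (1 : ℤ) := by
      cases K <;> simp [Model.coefficient]
    have hneg (K : Model k α) : K.coefficient (-1 : ℤ) = K.coefficient 1 := by
      cases K <;> simp [Model.coefficient]
    have := key (fun x => (if x = M.letter then (1 : ℤ) else 0) -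
        if x = τ M.letter then 1 else 0) fun x => by
      simp [hτ.injective.eq_iff, hτ.eq_iff]
    have h1 := hpos M
    have h2 := hpos N
    by_cases hN' : N.letter = τ M.letter
    · simp [hN', hfix, Ne.symm hfix, hneg] at this
      omega
    · simp [hab.symm, hN', Ne.symm hfix] at this
      omega

end Nano
end

section
/- For a fixed a ∈ α, two étale phrases P^{X₁;Y₁}_a and P^{X₂;Y₂}_a with (X₁;Y₁), (X₂;Y₂) ∈ {(1,1;l₁,l₂), (3;l), (2,1;l₁,l₂), (1,2;l₁,l₂), (1,1,1;l₁,l₂,l₃)} (with a ≠ τ(a) required for type (3;l)) are homotopic if and only if (X₁;Y₁) = (X₂;Y₂), i.e., they have the same type and the same indices. -/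
namespace Nano

variable {α : Type*}

variable {k : ℕ}

/-! ### Occurrences of letters, together with their components -/

/-- The occurrences of letters in a flattened phrase, each with the index of its component. -/
def occFlat : ℕ → List (Option (Letter α)) → List (ℕ × Letter α)
  | _, [] => []
  | c, none :: L => occFlat (c + 1) L
  | c, some A :: L => (c, A) :: occFlat c L

lemma occFlat_append (c : ℕ) (x y : List (Option (Letter α))) :
    occFlat c (x ++ y) = occFlat c x ++ occFlat (c + x.countP Option.isNone) y := by
  induction x generalizing c with
  | nil => simp [occFlat]
  | cons a x ih =>
    cases a with
    | none => simp [occFlat, ih, Nat.add_assoc, Nat.add_comm 1]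
    | some A => simp [occFlat, ih]

/-- The occurrences of letters in a phrase, with components numbered from `c`. -/
def occ : ℕ → Phrase α → List (ℕ × Letter α)
  | _, [] => []
  | c, w :: P => w.map (fun A => (c, A)) ++ occ (c + 1) P

lemma occFlat_map_some (c : ℕ) (w : List (Letter α)) :
    occFlat c (w.map some) = w.map fun A => (c, A) := by
  induction w with
  | nil => rfl
  | cons A w ih => simp [occFlat, ih]

lemma occFlat_flat (c : ℕ) (P : Phrase α) : occFlat c (flat P) = occ c P := by
  induction P generalizing c with
  | nil => rfl
  | cons w P ih =>
    cases P with
    | nil => simp [flat, occ, occFlat_map_some]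
    | cons v P =>
      have h : flat (w :: v :: P) = w.map some ++ (none :: flat (v :: P)) := by
        simp [flat, List.intercalate]
      rw [h, occFlat_append, occFlat_map_some, occFlat, ih, occ.eq_2 c w]
      simp [List.countP_map, Function.comp_def]

lemma map_snd_occ (c : ℕ) (P : Phrase α) : (occ c P).map Prod.snd = P.flatten := by
  induction P generalizing c with
  | nil => rfl
  | cons w P ih => simp [occ, ih, Function.comp_def]

lemma occ_rename (f : ℕ → ℕ) (c : ℕ) (P : Phrase α) :
    occ c (rename f P) = (occ c P).map fun u => (u.1, (f u.2.1, u.2.2)) := by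
  induction P generalizing c with
  | nil => rfl
  | cons w P ih =>
    have h : rename f (w :: P) = w.map (fun A => (f A.1, A.2)) :: rename f P := rfl
    simp [h, occ, ih]

/-! ### Sums over pairs of entries of a list -/

section PairSum

variable {β R : Type*} [AddCommMonoid R]

/-- The sum of `K u v` over all pairs of entries `u`, `v` of a list with `u` before `v`. -/
def pairSum (K : β → β → R) : List β → R
  | [] => 0
  | u :: L => (L.map (K u)).sum + pairSum K L

lemma pairSum_cons_of_forall {K : β → β → R} {p : β} {L : List β} (h : ∀ u ∈ L, K p u = 0) :
    pairSum K (p :: L) = pairSum K L := by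
  rw [pairSum, List.sum_eq_zero, zero_add]
  simpa using fun u hu => h u hu

lemma pairSum_remove {K : β → β → R} {q : β} {X Z : List β}
    (hX : ∀ u ∈ X, K u q = 0) (hZ : ∀ u ∈ Z, K q u = 0) :
    pairSum K (X ++ q :: Z) = pairSum K (X ++ Z) := by
  induction X with
  | nil => exact pairSum_cons_of_forall hZ
  | cons u X ih =>
    simp only [List.forall_mem_cons] at hX
    simp [pairSum, ih hX.2, hX.1]

lemma pairSum_extract {K : β → β → R} {p q : β} {X Y Z : List β}
    (hX : ∀ u ∈ X, K u p = 0 ∧ K u q = 0) (hY : ∀ u ∈ Y, K p u = 0 ∧ K u q = 0)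
    (hZ : ∀ u ∈ Z, K p u = 0 ∧ K q u = 0) :
    pairSum K (X ++ p :: (Y ++ q :: Z)) = pairSum K (X ++ (Y ++ Z)) + K p q := by
  induction X with
  | nil =>
    have h1 : (Y.map (K p)).sum = 0 := List.sum_eq_zero (by simpa using fun u hu => (hY u hu).1)
    have h2 : (Z.map (K p)).sum = 0 := List.sum_eq_zero (by simpa using fun u hu => (hZ u hu).1)
    have h3 := pairSum_remove (fun u hu => (hY u hu).2) (fun u hu => (hZ u hu).2)
    simp [pairSum, h1, h2, h3, add_comm]
  | cons u X ih =>
    simp only [List.forall_mem_cons] at hX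
    simp [pairSum, ih hX.2, hX.1, add_assoc]

lemma pairSum_map {γ : Type*} (K : β → β → R) (g : γ → β) (L : List γ) :
    pairSum K (L.map g) = pairSum (fun u v => K (g u) (g v)) L := by
  induction L with
  | nil => rfl
  | cons u L ih => simp [pairSum, ih, Function.comp_def]

end PairSum

/-! ### The linking invariant -/

/-- An occurrence of a letter, with its component, the height in front of it and the jump
of the height along it. -/
structure Site (α R : Type*) where
  comp : ℕ
  letter : Letter α
  height : R
  jump : R

section Invariant

variable {R : Type*} [CommRing R] [DecidableEq α] (ε : α → R) (j : ℕ)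

/-- The contribution of an occurrence `u` to the total weight of `A` in the component `j`. -/
def wt (u : ℕ × Letter α) (A : Letter α) : R :=
  if u.2 = A ∧ u.1 = j then ε A.2 else 0

/-- The total weight of the occurrences of `A` in the component `j`. -/
def total (T : List (ℕ × Letter α)) (A : Letter α) : R :=
  (T.map fun u => wt ε j u A).sum

/-- The sites of a list of occurrences. The jump at an occurrence of `A` is the weight of the
occurrences of `A` in the component `j` lying to its right minus the weight of those lying to its
left. The argument `D` is the difference of these weights, counting the current occurrence as
lying to the right. -/
def scan : (Letter α → R) → R → List (ℕ × Letter α) → List (Site α R)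
  | _, _, [] => []
  | D, h, u :: T => ⟨u.1, u.2, h, D u.2 - wt ε j u u.2⟩ ::
      scan (fun A => D A - 2 * wt ε j u A) (h + (D u.2 - wt ε j u u.2)) T

/-- The sum of the jumps of `scan`. -/
def rise : (Letter α → R) → List (ℕ × Letter α) → R
  | _, [] => 0
  | D, u :: T => (D u.2 - wt ε j u u.2) + rise (fun A => D A - 2 * wt ε j u A) T

variable {ε j}

lemma wt_of_ne {u : ℕ × Letter α} {A : Letter α} (h : u.2 ≠ A) : wt ε j u A = 0 := by
  simp [wt, h]

lemma total_cons (u : ℕ × Letter α) (T : List (ℕ × Letter α)) (A : Letter α) :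
    total ε j (u :: T) A = wt ε j u A + total ε j T A := by
  simp [total]

lemma total_nil (A : Letter α) : total ε j [] A = 0 := rfl

lemma total_append (x y : List (ℕ × Letter α)) (A : Letter α) :
    total ε j (x ++ y) A = total ε j x A + total ε j y A := by
  simp [total]

lemma total_of_notMem {T : List (ℕ × Letter α)} {A : Letter α} (h : A ∉ T.map Prod.snd) :
    total ε j T A = 0 := by
  refine List.sum_eq_zero ?_
  simp only [List.mem_map]
  rintro _ ⟨u, hu, rfl⟩
  exact wt_of_ne fun e => h (e ▸ List.mem_map_of_mem hu)

lemma scan_append (D : Letter α → R) (h : R) (x y : List (ℕ × Letter α)) :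
    scan ε j D h (x ++ y) = scan ε j D h x ++
      scan ε j (fun A => D A - 2 * total ε j x A) (h + rise ε j D x) y := by
  induction x generalizing D h with
  | nil => simp [scan, rise, total_nil]
  | cons u x ih => simp [scan, rise, total_cons, ih, mul_add, sub_sub, add_assoc]

lemma scan_congr {D D' : Letter α → R} {h : R} {x : List (ℕ × Letter α)}
    (hD : ∀ A ∈ x.map Prod.snd, D A = D' A) : scan ε j D h x = scan ε j D' h x := by
  induction x generalizing D D' h with
  | nil => rfl
  | cons u x ih =>
    simp only [List.map_cons, List.forall_mem_cons] at hD
    rw [scan, scan, hD.1, ih fun A hA => by rw [hD.2 A hA]]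

lemma rise_congr {D D' : Letter α → R} {x : List (ℕ × Letter α)}
    (hD : ∀ A ∈ x.map Prod.snd, D A = D' A) : rise ε j D x = rise ε j D' x := by
  induction x generalizing D D' with
  | nil => rfl
  | cons u x ih =>
    simp only [List.map_cons, List.forall_mem_cons] at hD
    rw [rise, rise, hD.1, ih fun A hA => by rw [hD.2 A hA]]

lemma map_letter_scan (D : Letter α → R) (h : R) (x : List (ℕ × Letter α)) :
    (scan ε j D h x).map Site.letter = x.map Prod.snd := by
  induction x generalizing D h with
  | nil => rfl
  | cons u x ih => simp [scan, ih]

variable (ε)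

/-- The contribution of a pair of sites: nonzero only when they carry the same letter, and then
determined by their components and the rise of the height strictly between them. -/
def link (κ : ℕ → ℕ → R → R) (p q : Site α R) : R :=
  if p.letter = q.letter then
    κ p.comp q.comp (q.height - (p.height + p.jump)) * ε p.letter.2
  else 0

variable (j) in
/-- The linking invariant of a list of occurrences. -/
def linkSum (κ : ℕ → ℕ → R → R) (T : List (ℕ × Letter α)) : R :=
  pairSum (link ε κ) (scan ε j (total ε j T) 0 T)

variable {ε}

lemma link_eq_zero_of_notMem {κ : ℕ → ℕ → R → R} {L : List (Site α R)} {p : Site α R}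
    (h : p.letter ∉ L.map Site.letter) : ∀ u ∈ L, link ε κ p u = 0 ∧ link ε κ u p = 0 := by
  intro u hu
  have hne : u.letter ≠ p.letter := fun e => h (e ▸ List.mem_map_of_mem hu)
  simp [link, hne, hne.symm]

/-- A letter occurring only at two given sites contributes exactly its own linking term. -/
lemma pairSum_link_extract {κ : ℕ → ℕ → R → R} {p q : Site α R} {X Y Z : List (Site α R)}
    (hpq : q.letter = p.letter) (hX : p.letter ∉ X.map Site.letter)
    (hY : p.letter ∉ Y.map Site.letter) (hZ : p.letter ∉ Z.map Site.letter) :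
    pairSum (link ε κ) (X ++ p :: (Y ++ q :: Z)) =
      pairSum (link ε κ) (X ++ (Y ++ Z)) + link ε κ p q := by
  refine pairSum_extract (fun u hu => ?_) (fun u hu => ?_) fun u hu => ?_
  · exact ⟨(link_eq_zero_of_notMem hX u hu).2, (link_eq_zero_of_notMem (hpq ▸ hX) u hu).2⟩
  · exact ⟨(link_eq_zero_of_notMem hY u hu).1, (link_eq_zero_of_notMem (hpq ▸ hY) u hu).2⟩
  · exact ⟨(link_eq_zero_of_notMem hZ u hu).1, (link_eq_zero_of_notMem (hpq ▸ hZ) u hu).1⟩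

lemma pairSum_link_extract_two {κ : ℕ → ℕ → R → R} {a a' b b' : Site α R}
    {X Y Z : List (Site α R)} (ha : a'.letter = a.letter) (hb : b'.letter = b.letter)
    (hab : a.letter ≠ b.letter)
    (haX : a.letter ∉ X.map Site.letter) (haY : a.letter ∉ Y.map Site.letter)
    (haZ : a.letter ∉ Z.map Site.letter) (hbX : b.letter ∉ X.map Site.letter)
    (hbY : b.letter ∉ Y.map Site.letter) (hbZ : b.letter ∉ Z.map Site.letter) :
    pairSum (link ε κ) (X ++ a :: b :: (Y ++ b' :: a' :: Z)) =
      pairSum (link ε κ) (X ++ (Y ++ Z)) + link ε κ a a' + link ε κ b b' := by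
  have h1 := pairSum_link_extract (κ := κ) (ε := ε) (p := a) (q := a') (X := X)
    (Y := b :: Y ++ [b']) (Z := Z) ha haX (by simp_all) haZ
  have h2 := pairSum_link_extract (κ := κ) (ε := ε) hb hbX hbY hbZ
  simp only [List.append_assoc, List.cons_append, List.nil_append] at h1 h2
  rw [h1, h2]
  ring

lemma pairSum_link_extract_three {κ : ℕ → ℕ → R → R} {a a' b b' c c' : Site α R}
    {X Y Z W : List (Site α R)} (ha : a'.letter = a.letter) (hb : b'.letter = b.letter)
    (hc : c'.letter = c.letter) (hab : a.letter ≠ b.letter) (hac : a.letter ≠ c.letter)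
    (hbc : b.letter ≠ c.letter)
    (haL : a.letter ∉ (X ++ (Y ++ (Z ++ W))).map Site.letter)
    (hbL : b.letter ∉ (X ++ (Y ++ (Z ++ W))).map Site.letter)
    (hcL : c.letter ∉ (X ++ (Y ++ (Z ++ W))).map Site.letter) :
    pairSum (link ε κ) (X ++ a :: b :: (Y ++ a' :: c :: (Z ++ b' :: c' :: W))) =
        pairSum (link ε κ) (X ++ (Y ++ (Z ++ W))) +
          (link ε κ a a' + link ε κ b b' + link ε κ c c') ∧
    pairSum (link ε κ) (X ++ b :: a :: (Y ++ c :: a' :: (Z ++ c' :: b' :: W))) =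
        pairSum (link ε κ) (X ++ (Y ++ (Z ++ W))) +
          (link ε κ a a' + link ε κ b b' + link ε κ c c') := by
  simp only [List.map_append, List.mem_append, not_or] at haL hbL hcL
  have hc0 := pairSum_link_extract (κ := κ) (ε := ε) (X := X ++ Y) (Y := Z) (Z := W) hc
    (by simp [hcL]) hcL.2.2.1 hcL.2.2.2
  constructor
  · have ha1 := pairSum_link_extract (κ := κ) (ε := ε) (X := X) (Y := b :: Y)
      (Z := c :: (Z ++ b' :: c' :: W)) ha haL.1 (by simp_all) (by simp_all)
    have hb1 := pairSum_link_extract (κ := κ) (ε := ε) (X := X) (Y := Y ++ c :: Z)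
      (Z := c' :: W) hb hbL.1 (by simp_all) (by simp_all)
    simp only [List.append_assoc, List.cons_append] at ha1 hb1 hc0
    rw [ha1, hb1, hc0]
    ring
  · have hb1 := pairSum_link_extract (κ := κ) (ε := ε) (X := X)
      (Y := a :: (Y ++ c :: a' :: (Z ++ [c']))) (Z := W) hb hbL.1 (by simp_all [hab.symm])
      (by simp_all)
    have ha1 := pairSum_link_extract (κ := κ) (ε := ε) (X := X) (Y := Y ++ [c])
      (Z := Z ++ c' :: W) ha haL.1 (by simp_all) (by simp_all)
    simp only [List.append_assoc, List.cons_append, List.nil_append] at ha1 hb1 hc0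
    rw [hb1, ha1, hc0]
    ring

lemma linkSum_rename (κ : ℕ → ℕ → R → R) {f : Letter α → Letter α}
    (hf : Function.Injective f) (hf2 : ∀ A, (f A).2 = A.2) (T : List (ℕ × Letter α)) :
    linkSum ε j κ (T.map fun u => (u.1, f u.2)) = linkSum ε j κ T := by
  have hwt (u : ℕ × Letter α) (A : Letter α) : wt ε j (u.1, f u.2) (f A) = wt ε j u A := by
    simp [wt, hf.eq_iff, hf2]
  have hscan (D D' : Letter α → R) (hD : ∀ A, D (f A) = D' A) (h : R) :
      scan ε j D h (T.map fun u => (u.1, f u.2)) =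
        (scan ε j D' h T).map fun p => ⟨p.comp, f p.letter, p.height, p.jump⟩ := by
    induction T generalizing D D' h with
    | nil => rfl
    | cons u T ih =>
      rw [List.map_cons, scan, scan, List.map_cons,
        ih _ (fun A => D' A - 2 * wt ε j u A) fun A => by rw [hD, hwt]]
      simp [hwt, hD]
  rw [linkSum, linkSum, hscan _ (total ε j T), pairSum_map]
  · congr 1
    funext p q
    simp [link, hf.eq_iff, hf2]
  · intro A
    simp [total, Function.comp_def, hwt]

lemma linkSum_h1 {κ : ℕ → ℕ → R → R} (hκ : ∀ c, κ c c 0 = 0) {A : Letter α} {c : ℕ}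
    {x y : List (ℕ × Letter α)} (hx : A ∉ x.map Prod.snd) (hy : A ∉ y.map Prod.snd) :
    linkSum ε j κ (x ++ [(c, A), (c, A)] ++ y) = linkSum ε j κ (x ++ y) := by
  set D := total ε j (x ++ [(c, A), (c, A)] ++ y) with hD
  have hDA : D A - 2 * total ε j x A = 2 * wt ε j (c, A) A := by
    simp [hD, total_append, total_cons, total_of_notMem hx, total_of_notMem hy]; ring
  have hDB (B : Letter α) (hB : B ≠ A) : D B = total ε j (x ++ y) B := by
    simp [hD, total_append, total_cons, wt_of_ne (ε := ε) (j := j) (u := (c, A)) hB.symm]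
  have hDx : ∀ B ∈ x.map Prod.snd, D B = total ε j (x ++ y) B :=
    fun B hB => hDB B fun e => hx (e ▸ hB)
  have hrise : rise ε j (fun B => D B - 2 * total ε j x B) [(c, A), (c, A)] = 0 := by
    simp only [rise, hDA]; ring
  rw [linkSum, linkSum, ← hD, List.append_assoc, scan_append, scan_append, scan_append,
    scan_congr hDx, rise_congr hDx, hrise, add_zero]
  rw [scan_congr (x := y) (D' := fun B => total ε j (x ++ y) B - 2 * total ε j x B)]
  · simp only [scan, List.cons_append, List.nil_append]
    rw [← List.nil_append (_ :: scan ε j _ _ y), pairSum_link_extract]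
    · simp [link, hκ]
    · rfl
    · simpa [map_letter_scan] using hx
    · simp
    · simpa [map_letter_scan] using hy
  · intro B hB
    have hBA : B ≠ A := fun e => hy (e ▸ hB)
    simp [hDB B hBA, total_cons, total_nil, wt_of_ne (ε := ε) (j := j) (u := (c, A)) hBA.symm]

lemma linkSum_h2 {κ : ℕ → ℕ → R → R} (hκ : ∀ c c' w w', c ≠ c' → κ c c' w = κ c c' w')
    {A B : Letter α} {c d : ℕ} {x y z : List (ℕ × Letter α)} (hAB : A ≠ B)
    (hε : ε B.2 = -ε A.2)
    (hAx : A ∉ x.map Prod.snd) (hAy : A ∉ y.map Prod.snd) (hAz : A ∉ z.map Prod.snd)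
    (hBx : B ∉ x.map Prod.snd) (hBy : B ∉ y.map Prod.snd) (hBz : B ∉ z.map Prod.snd) :
    linkSum ε j κ (x ++ [(c, A), (c, B)] ++ y ++ [(d, B), (d, A)] ++ z) =
      linkSum ε j κ (x ++ y ++ z) := by
  set D := total ε j (x ++ [(c, A), (c, B)] ++ y ++ [(d, B), (d, A)] ++ z) with hD
  have hwAB (e : ℕ) : wt ε j (e, A) B = 0 := wt_of_ne hAB
  have hwBA (e : ℕ) : wt ε j (e, B) A = 0 := wt_of_ne hAB.symm
  have hwB (e : ℕ) : wt ε j (e, B) B = -wt ε j (e, A) A := by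
    by_cases h : e = j <;> simp [wt, h, hε]
  have hDA : D A = wt ε j (c, A) A + wt ε j (d, A) A := by
    simp [hD, total_append, total_cons, total_of_notMem hAx, total_of_notMem hAy,
      total_of_notMem hAz, hwBA]
  have hDB : D B = -(wt ε j (c, A) A + wt ε j (d, A) A) := by
    simp [hD, total_append, total_cons, total_of_notMem hBx, total_of_notMem hBy,
      total_of_notMem hBz, hwAB, hwB]; ring
  have hDE (E : Letter α) (hA : E ≠ A) (hB : E ≠ B) : D E = total ε j (x ++ y ++ z) E := by
    simp [hD, total_append, total_cons, wt_of_ne, hA.symm, hB.symm]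
  have htx : total ε j x A = 0 := total_of_notMem hAx
  have htx' : total ε j x B = 0 := total_of_notMem hBx
  have hty : total ε j y A = 0 := total_of_notMem hAy
  have hty' : total ε j y B = 0 := total_of_notMem hBy
  have hDx : ∀ E ∈ x.map Prod.snd, D E = total ε j (x ++ y ++ z) E :=
    fun E hE => hDE E (fun e => hAx (e ▸ hE)) fun e => hBx (e ▸ hE)
  have hDy : ∀ E ∈ y.map Prod.snd,
      D E - 2 * total ε j x E - 2 * total ε j [(c, A), (c, B)] E =
        total ε j (x ++ y ++ z) E - 2 * total ε j x E := by
    intro E hE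
    have hA : E ≠ A := fun e => hAy (e ▸ hE)
    have hB : E ≠ B := fun e => hBy (e ▸ hE)
    simp [hDE E hA hB, total_cons, total_nil, wt_of_ne, hA.symm, hB.symm]
  have hDz : ∀ E ∈ z.map Prod.snd,
      D E - 2 * total ε j x E - 2 * total ε j [(c, A), (c, B)] E - 2 * total ε j y E
          - 2 * total ε j [(d, B), (d, A)] E =
        total ε j (x ++ y ++ z) E - 2 * total ε j x E - 2 * total ε j y E := by
    intro E hE
    have hA : E ≠ A := fun e => hAz (e ▸ hE)
    have hB : E ≠ B := fun e => hBz (e ▸ hE)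
    simp [hDE E hA hB, total_cons, total_nil, wt_of_ne, hA.symm, hB.symm]
  have hr1 : rise ε j (fun E => D E - 2 * total ε j x E) [(c, A), (c, B)] = 0 := by
    simp only [rise, hDA, hDB, htx, htx', hwAB, hwB]; ring
  have hr2 : rise ε j (fun E => D E - 2 * total ε j x E - 2 * total ε j [(c, A), (c, B)] E
      - 2 * total ε j y E) [(d, B), (d, A)] = 0 := by
    simp only [rise, hDA, hDB, htx, htx', hty, hty', hwAB, hwBA, hwB, total_cons, total_nil]; ring
  rw [linkSum, linkSum, ← hD]
  simp only [List.append_assoc] at hDx hDy hDz ⊢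
  simp only [scan_append, hr1, hr2, add_zero]
  rw [scan_congr hDx, rise_congr hDx, scan_congr hDy, rise_congr hDy, scan_congr hDz]
  set X := scan ε j _ _ x
  set Y := scan ε j _ _ y
  set Z := scan ε j _ _ z
  have hXm : X.map Site.letter = x.map Prod.snd := map_letter_scan _ _ _
  have hYm : Y.map Site.letter = y.map Prod.snd := map_letter_scan _ _ _
  have hZm : Z.map Site.letter = z.map Prod.snd := map_letter_scan _ _ _
  simp only [scan, List.cons_append, List.nil_append]
  rw [pairSum_link_extract_two, add_assoc]
  · refine add_eq_left.mpr ?_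
    by_cases hcd : c = d
    · subst hcd
      simp only [link, if_true, hDA, hDB, htx, htx', hty', hwAB, hwB, total_cons, total_nil, hε]
      ring_nf
    · simp only [link, if_true, hε]
      rw [hκ c d _ 0 hcd]
      nth_rw 2 [hκ c d _ 0 hcd]
      ring
  all_goals first | rfl | simpa only [hXm, hYm, hZm]

lemma linkSum_h3 {κ : ℕ → ℕ → R → R} {A B C : Letter α} {c d e : ℕ}
    {x y z t : List (ℕ × Letter α)} (hAB : A ≠ B) (hAC : A ≠ C) (hBC : B ≠ C)
    (hεB : ε B.2 = ε A.2) (hεC : ε C.2 = ε A.2)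
    (hA : A ∉ (x ++ (y ++ (z ++ t))).map Prod.snd)
    (hB : B ∉ (x ++ (y ++ (z ++ t))).map Prod.snd)
    (hC : C ∉ (x ++ (y ++ (z ++ t))).map Prod.snd) :
    linkSum ε j κ (x ++ [(c, A), (c, B)] ++ y ++ [(d, A), (d, C)] ++ z ++ [(e, B), (e, C)] ++ t) =
      linkSum ε j κ
        (x ++ [(c, B), (c, A)] ++ y ++ [(d, C), (d, A)] ++ z ++ [(e, C), (e, B)] ++ t) := by
  have hwAB (i : ℕ) : wt ε j (i, A) B = 0 := wt_of_ne hAB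
  have hwBA (i : ℕ) : wt ε j (i, B) A = 0 := wt_of_ne hAB.symm
  have hwAC (i : ℕ) : wt ε j (i, A) C = 0 := wt_of_ne hAC
  have hwCA (i : ℕ) : wt ε j (i, C) A = 0 := wt_of_ne hAC.symm
  have hwBC (i : ℕ) : wt ε j (i, B) C = 0 := wt_of_ne hBC
  have hwCB (i : ℕ) : wt ε j (i, C) B = 0 := wt_of_ne hBC.symm
  have hwB (i : ℕ) : wt ε j (i, B) B = wt ε j (i, A) A := by simp [wt, hεB]
  have hwC (i : ℕ) : wt ε j (i, C) C = wt ε j (i, A) A := by simp [wt, hεC]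
  have htotal {E : Letter α} (hE : E ∉ (x ++ (y ++ (z ++ t))).map Prod.snd) :
      total ε j x E = 0 ∧ total ε j y E = 0 ∧ total ε j z E = 0 ∧ total ε j t E = 0 := by
    simp only [List.map_append, List.mem_append, not_or] at hE
    exact ⟨total_of_notMem hE.1, total_of_notMem hE.2.1, total_of_notMem hE.2.2.1,
      total_of_notMem hE.2.2.2⟩
  have htA := htotal hA
  have htB := htotal hB
  have htC := htotal hC
  have hpair (u v : ℕ × Letter α) : total ε j [u, v] = total ε j [v, u] := by
    funext E; simp only [total_cons, total_nil]; ring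
  have htot : total ε j
      (x ++ [(c, B), (c, A)] ++ y ++ [(d, C), (d, A)] ++ z ++ [(e, C), (e, B)] ++ t) =
      total ε j
        (x ++ [(c, A), (c, B)] ++ y ++ [(d, A), (d, C)] ++ z ++ [(e, B), (e, C)] ++ t) := by
    funext E; simp only [total_append, hpair]
  have hrise (D : Letter α → R) (u v : ℕ × Letter α) (huv : u.2 ≠ v.2) :
      rise ε j D [u, v] = rise ε j D [v, u] := by
    simp only [rise, wt_of_ne huv, wt_of_ne huv.symm]; ring
  rw [linkSum, linkSum, htot]
  set D := total ε j
    (x ++ [(c, A), (c, B)] ++ y ++ [(d, A), (d, C)] ++ z ++ [(e, B), (e, C)] ++ t) with hD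
  have hDA : D A = wt ε j (c, A) A + wt ε j (d, A) A := by
    simp [hD, total_append, total_cons, htA, hwBA, hwCA]
  have hDB : D B = wt ε j (c, A) A + wt ε j (e, A) A := by
    simp [hD, total_append, total_cons, htB, hwAB, hwCB, hwB]
  have hDC : D C = wt ε j (d, A) A + wt ε j (e, A) A := by
    simp [hD, total_append, total_cons, htC, hwAC, hwBC, hwC]
  simp only [List.append_assoc, scan_append]
  rw [hpair (c, B), hpair (d, C), hpair (e, C), hrise _ (c, B) (c, A) hAB.symm,
    hrise _ (d, C) (d, A) hAC.symm, hrise _ (e, C) (e, B) hBC.symm]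
  set X := scan ε j _ _ x
  set Y := scan ε j _ _ y
  set Z := scan ε j _ _ z
  set W := scan ε j _ _ t
  have hm : (X ++ (Y ++ (Z ++ W))).map Site.letter = (x ++ (y ++ (z ++ t))).map Prod.snd := by
    simp [X, Y, Z, W, map_letter_scan]
  simp only [scan, List.cons_append, List.nil_append]
  rw [(pairSum_link_extract_three _ _ _ _ _ _ _ _ _).1,
    (pairSum_link_extract_three _ _ _ _ _ _ _ _ _).2]
  · simp only [link, if_true, rise, hDA, hDB, hDC, htA, htB, htC, hwAB, hwBA, hwAC, hwBC, hwCB,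
      hwB, hwC, total_cons, total_nil, hεB, hεC]
    ring_nf
  all_goals first | rfl | assumption | (rw [hm]; assumption)

lemma count_occFlat {P : Phrase α} (hP : IsGauss P) {A : Letter α}
    (hA : A ∈ (occFlat 0 (flat P)).map Prod.snd) :
    ((occFlat 0 (flat P)).map Prod.snd).count A = 2 := by
  rw [occFlat_flat, map_snd_occ] at *
  exact hP A hA

lemma linkSum_move {τ : α → α} (hε : ∀ b, ε (τ b) = -ε b) {κ : ℕ → ℕ → R → R}
    (hκ : ∀ c, κ c c 0 = 0) (hκ' : ∀ c c' w w', c ≠ c' → κ c c' w = κ c c' w')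
    {P Q : Phrase α} (h : Move τ P Q) (hP : IsGauss P) :
    linkSum ε j κ (occ 0 P) = linkSum ε j κ (occ 0 Q) := by
  have hcount := fun A => count_occFlat hP (A := A)
  cases h with
  | iso f hf P =>
    rw [occ_rename, linkSum_rename κ (f := fun A => (f A.1, A.2))]
    · intro A B hAB
      simp only [Prod.mk.injEq, hf.eq_iff] at hAB
      exact Prod.ext hAB.1 hAB.2
    · exact fun _ => rfl
  | h1 _ _ A x y hPe hQe =>
    rw [← occFlat_flat, ← occFlat_flat, hPe, hQe]
    rw [hPe] at hcount
    simp only [occFlat_append, occFlat, List.map_append, List.count_append, List.map_cons,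
      List.map_nil, List.count_cons, List.count_nil, List.mem_append, List.mem_cons,
      List.countP_append, List.countP_cons, List.countP_nil, Option.isNone_some,
      Bool.false_eq_true, if_false, add_zero] at hcount ⊢
    have hA := hcount A (by simp)
    simp only [beq_self_eq_true, if_true] at hA
    exact linkSum_h1 hκ (List.count_eq_zero.mp (by omega)) (List.count_eq_zero.mp (by omega))
  | h2 _ _ A B x y z hAB hPe hQe =>
    rw [← occFlat_flat, ← occFlat_flat, hPe, hQe]
    rw [hPe] at hcount
    simp only [occFlat_append, occFlat, List.map_append, List.count_append, List.map_cons,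
      List.map_nil, List.count_cons, List.count_nil, List.mem_append, List.mem_cons,
      List.countP_append, List.countP_cons, List.countP_nil, Option.isNone_some,
      Bool.false_eq_true, if_false, add_zero] at hcount ⊢
    have hA := hcount A (by simp)
    have hB := hcount B (by simp)
    have hne : A ≠ B := by
      rintro rfl
      simp only [beq_self_eq_true, if_true] at hA
      omega
    simp only [beq_self_eq_true, if_true] at hA hB
    refine linkSum_h2 hκ' hne (by rw [hAB, hε]) ?_ ?_ ?_ ?_ ?_ ?_ <;>
      exact List.count_eq_zero.mp (by omega)
  | h3 _ _ A B C x y z t hAB hBC hPe hQe =>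
    rw [← occFlat_flat, ← occFlat_flat, hPe, hQe]
    rw [hPe] at hcount
    simp only [occFlat_append, occFlat, List.map_append, List.count_append, List.map_cons,
      List.map_nil, List.count_cons, List.count_nil, List.mem_append, List.mem_cons,
      List.countP_append, List.countP_cons, List.countP_nil, Option.isNone_some,
      Bool.false_eq_true, if_false, add_zero] at hcount ⊢
    have hA := hcount A (by simp)
    have hB := hcount B (by simp)
    have hC := hcount C (by simp)
    have hAB' : A ≠ B := by
      rintro rfl
      simp only [beq_self_eq_true, if_true] at hA
      omega
    have hAC' : A ≠ C := by
      rintro rfl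
      simp only [beq_self_eq_true, if_true] at hA
      omega
    have hBC' : B ≠ C := by
      rintro rfl
      simp only [beq_self_eq_true, if_true] at hB
      omega
    simp only [beq_self_eq_true, if_true] at hA hB hC
    refine linkSum_h3 hAB' hAC' hBC' (by rw [hAB]) (by rw [hAB, hBC]) ?_ ?_ ?_ <;>
      · simp only [List.map_append]
        refine List.count_eq_zero.mp ?_
        simp only [List.count_append]
        omega

lemma linkSum_homotopic {τ : α → α} (hε : ∀ b, ε (τ b) = -ε b) {κ : ℕ → ℕ → R → R}
    (hκ : ∀ c, κ c c 0 = 0) (hκ' : ∀ c c' w w', c ≠ c' → κ c c' w = κ c c' w')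
    {P Q : Phrase α} (h : Homotopic τ P Q) :
    linkSum ε j κ (occ 0 P) = linkSum ε j κ (occ 0 Q) := by
  induction h with
  | refl => rfl
  | tail _ h ih =>
    obtain ⟨h | h, hX, hY⟩ := h
    · exact ih.trans (linkSum_move hε hκ hκ' h hX.1)
    · exact ih.trans (linkSum_move hε hκ hκ' h hY.1).symm

end Invariant

/-! ### Occurrences in desingularized model phrases -/

section Desing

variable [DecidableEq α]

/-- The desingularization of a list of occurrences. -/
def desingOcc (m : Letter α → ℕ) :
    List (ℕ × Letter α) → (Letter α → ℕ) → List (ℕ × Letter α)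
  | [], _ => []
  | u :: T, seen => (repl u.2 (seen u.2 + 1) (m u.2)).map (fun A => (u.1, A)) ++
      desingOcc m T (fun B => if B = u.2 then seen B + 1 else seen B)

lemma desingOcc_append (m : Letter α → ℕ) (c : ℕ) (w : List (Letter α)) (seen : Letter α → ℕ)
    (T : List (ℕ × Letter α)) :
    desingOcc m (w.map (fun A => (c, A)) ++ T) seen =
      (desingWord m w seen).map (fun A => (c, A)) ++
        desingOcc m T (fun B => seen B + w.count B) := by
  induction w generalizing seen with
  | nil => simp [desingWord]
  | cons A w ih =>
    have h : (fun B => (if B = A then seen B + 1 else seen B) + w.count B) =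
        fun B => seen B + (A :: w).count B := by
      funext B
      by_cases hB : B = A
      · simp [hB]; ring
      · simp [hB, List.count_cons_of_ne (Ne.symm hB)]
    simp [desingOcc, desingWord, ih, h]

lemma occ_desingAux (m : Letter α → ℕ) (c : ℕ) (P : Phrase α) (seen : Letter α → ℕ) :
    occ c (desingAux m P seen) = desingOcc m (occ c P) seen := by
  induction P generalizing c seen with
  | nil => rfl
  | cons w P ih => rw [desingAux, occ, occ, desingOcc_append, ih]

lemma occ_desing (P : Phrase α) :
    occ 0 (desing P) =
      desingOcc (fun A => ((occ 0 P).map Prod.snd).count A) (occ 0 P) fun _ => 0 := by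
  rw [desing, occ_desingAux, map_snd_occ]

end Desing

lemma occ_ofFn (g : ℕ → List (Letter α)) (c n : ℕ) :
    occ c (List.ofFn fun i : Fin n => g (c + i)) =
      (List.range' c n).flatMap fun i => (g i).map fun A => (i, A) := by
  induction n generalizing c with
  | zero => simp [occ]
  | succ n ih => simp [List.ofFn_succ, occ, List.range'_succ, ← ih, Nat.add_assoc, Nat.add_comm 1]

lemma flatMap_range'_eq_nil {β : Type*} {g : ℕ → List β} {s n : ℕ}
    (h : ∀ i, s ≤ i → g i = []) : (List.range' s n).flatMap g = [] := by
  simp only [List.flatMap_eq_nil_iff, List.mem_range']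
  rintro _ ⟨i, _, rfl⟩
  exact h _ (by omega)

lemma flatMap_range'_eq_append {β : Type*} {g : ℕ → List β} {s n l : ℕ} (hs : s ≤ l)
    (hl : l < s + n) (h : ∀ i, s ≤ i → i < l → g i = []) :
    (List.range' s n).flatMap g =
      g l ++ (List.range' (l + 1) (s + n - (l + 1))).flatMap g := by
  induction n generalizing s with
  | zero => omega
  | succ n ih =>
    rw [List.range'_succ, List.flatMap_cons]
    rcases hs.eq_or_lt with rfl | hlt
    · congr 4; omega
    · rw [h s le_rfl hlt, ih hlt (by omega) fun i hi => h i (by omega), List.nil_append]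
      congr 4; omega

lemma desingOcc_three [DecidableEq α] (a : α) (c₁ c₂ c₃ : ℕ) (m : Letter α → ℕ)
    (hm : m (ofα a) = 3) :
    desingOcc m [(c₁, ofα a), (c₂, ofα a), (c₃, ofα a)] (fun _ => 0) =
      [(c₁, dLetter (ofα a) 1 2), (c₁, dLetter (ofα a) 1 3),
        (c₂, dLetter (ofα a) 1 2), (c₂, dLetter (ofα a) 2 3),
        (c₃, dLetter (ofα a) 1 3), (c₃, dLetter (ofα a) 2 3)] := by
  simp [desingOcc, repl, hm, List.range_succ]

lemma desingOcc_two [DecidableEq α] (a : α) (c₁ c₂ : ℕ) (m : Letter α → ℕ)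
    (hm : m (ofα a) = 2) :
    desingOcc m [(c₁, ofα a), (c₂, ofα a)] (fun _ => 0) =
      [(c₁, dLetter (ofα a) 1 2), (c₂, dLetter (ofα a) 1 2)] := by
  simp [desingOcc, repl, hm, List.range_succ]

lemma dLetter_inj (A : Letter α) (p q r s : ℕ) :
    dLetter A p q = dLetter A r s ↔ p = r ∧ q = s := by
  simp [dLetter]

section Values

variable [DecidableEq α] {R : Type*} [CommRing R] {ε : α → R} {a : α}

lemma linkSum_two (ha : ε a = 1) (j : ℕ) (κ : ℕ → ℕ → R → R) (c₁ c₂ : ℕ) {P : Phrase α}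
    (hP : occ 0 P = [(c₁, ofα a), (c₂, ofα a)]) :
    linkSum ε j κ (occ 0 (desing P)) = κ c₁ c₂ 0 := by
  rw [occ_desing, hP, desingOcc_two _ _ _ _ (by simp)]
  have h : (dLetter (ofα a) 1 2).2 = a := rfl
  simp [linkSum, scan, pairSum, link, h, ha]

lemma linkSum_three (ha : ε a = 1) (j : ℕ) (κ : ℕ → ℕ → R → R) (c₁ c₂ c₃ : ℕ) {P : Phrase α}
    (hP : occ 0 P = [(c₁, ofα a), (c₂, ofα a), (c₃, ofα a)]) :
    linkSum ε j κ (occ 0 (desing P)) =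
      κ c₁ c₂ (if c₃ = j then 1 else 0) +
        κ c₁ c₃ ((if c₃ = j then 1 else 0) - if c₁ = j then 1 else 0) +
        κ c₂ c₃ (-if c₁ = j then 1 else 0) := by
  rw [occ_desing, hP, desingOcc_three _ _ _ _ _ (by simp)]
  have h (p q : ℕ) : (dLetter (ofα a) p q).2 = a := rfl
  simp [linkSum, scan, pairSum, link, h, ha, dLetter_inj, total, wt]
  split_ifs <;> ring_nf

end Values

lemma occ_P11 {k : ℕ} {l1 l2 : Fin k} (h : l1 < l2) (a : α) :
    occ 0 (P11 k l1 l2 a) = [((l1 : ℕ), ofα a), ((l2 : ℕ), ofα a)] := by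
  have h0 := occ_ofFn (fun i => if i = (l1 : ℕ) ∨ i = (l2 : ℕ) then [ofα a] else []) 0 k
  simp only [zero_add, ← Fin.ext_iff] at h0
  rw [P11, h0, flatMap_range'_eq_append (l := l1), flatMap_range'_eq_append (l := l2),
    flatMap_range'_eq_nil]
  · simp
  all_goals grind

lemma occ_P3 {k : ℕ} (l : Fin k) (a : α) :
    occ 0 (P3 k l a) = [((l : ℕ), ofα a), ((l : ℕ), ofα a), ((l : ℕ), ofα a)] := by
  have h0 := occ_ofFn (fun i => if i = (l : ℕ) then [ofα a, ofα a, ofα a] else []) 0 k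
  simp only [zero_add, ← Fin.ext_iff] at h0
  rw [P3, h0, flatMap_range'_eq_append (l := l), flatMap_range'_eq_nil]
  · simp
  all_goals grind

lemma occ_P21 {k : ℕ} {l1 l2 : Fin k} (h : l1 < l2) (a : α) :
    occ 0 (P21 k l1 l2 a) = [((l1 : ℕ), ofα a), ((l1 : ℕ), ofα a), ((l2 : ℕ), ofα a)] := by
  have h0 := occ_ofFn (fun i => if i = (l1 : ℕ) then [ofα a, ofα a] else
    if i = (l2 : ℕ) then [ofα a] else []) 0 k
  simp only [zero_add, ← Fin.ext_iff] at h0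
  rw [P21, h0, flatMap_range'_eq_append (l := l1), flatMap_range'_eq_append (l := l2),
    flatMap_range'_eq_nil]
  · simp [show (l2 : ℕ) ≠ l1 by omega]
  all_goals grind

lemma occ_P12 {k : ℕ} {l1 l2 : Fin k} (h : l1 < l2) (a : α) :
    occ 0 (P12 k l1 l2 a) = [((l1 : ℕ), ofα a), ((l2 : ℕ), ofα a), ((l2 : ℕ), ofα a)] := by
  have h0 := occ_ofFn (fun i => if i = (l1 : ℕ) then [ofα a] else
    if i = (l2 : ℕ) then [ofα a, ofα a] else []) 0 k
  simp only [zero_add, ← Fin.ext_iff] at h0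
  rw [P12, h0, flatMap_range'_eq_append (l := l1), flatMap_range'_eq_append (l := l2),
    flatMap_range'_eq_nil]
  · simp [show (l2 : ℕ) ≠ l1 by omega]
  all_goals grind

lemma occ_P111 {k : ℕ} {l1 l2 l3 : Fin k} (h : l1 < l2) (h' : l2 < l3) (a : α) :
    occ 0 (P111 k l1 l2 l3 a) =
      [((l1 : ℕ), ofα a), ((l2 : ℕ), ofα a), ((l3 : ℕ), ofα a)] := by
  have h0 := occ_ofFn (fun i => if i = (l1 : ℕ) ∨ i = (l2 : ℕ) ∨ i = (l3 : ℕ) then [ofα a]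
    else []) 0 k
  simp only [zero_add, ← Fin.ext_iff] at h0
  rw [P111, h0, flatMap_range'_eq_append (l := l1), flatMap_range'_eq_append (l := l2),
    flatMap_range'_eq_append (l := l3), flatMap_range'_eq_nil]
  · simp
  all_goals grind

/-! ### Distinguishing the model phrases -/

section Distinguish

variable {R : Type*} [CommRing R] {ε : α → R} {τ : α → α} {k : ℕ}

/-- The letters with both occurrences in the component `i` and with linking `v`. -/
def selfKernel [DecidableEq R] (i : ℕ) (v : R) (c c' : ℕ) (w : R) : R :=
  if c = i ∧ c' = i ∧ w = v then 1 else 0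

/-- The letters with first occurrence in the component `i` and second in the component `i'`. -/
def crossKernel (i i' : ℕ) (c c' : ℕ) (_ : R) : R :=
  if c = i ∧ c' = i' then 1 else 0

/-- The pairs `(i, j)` such that some letter of the component `i` detectably links the
component `j`. -/
def Model.SelfLinks : Model k α → Fin k → Fin k → Prop
  | .m11 _ _ _, _, _ => False
  | .m3 l _, i, j => i = l ∧ j = l
  | .m21 l1 l2 _, i, j => i = l1 ∧ j = l2
  | .m12 l1 l2 _, i, j => i = l2 ∧ j = l1
  | .m111 _ _ _ _, _, _ => False

variable [DecidableEq α]

lemma linkSum_crossKernel_m11 {l1 l2 : Fin k} (h : l1 < l2) {a : α} (ha : ε a = 1)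
    (i j : Fin k) :
    linkSum ε 0 (crossKernel i j) (occ 0 (desing (P11 k l1 l2 a))) =
      if l1 = i ∧ l2 = j then 1 else 0 := by
  simp only [linkSum_two ha _ _ _ _ (occ_P11 h a), crossKernel, Fin.val_inj]

lemma linkSum_crossKernel_m111 {l1 l2 l3 : Fin k} (h : l1 < l2) (h' : l2 < l3) {a : α}
    (ha : ε a = 1) (i j : Fin k) :
    linkSum ε 0 (crossKernel i j) (occ 0 (desing (P111 k l1 l2 l3 a))) =
      if (l1 = i ∧ l2 = j) ∨ (l1 = i ∧ l3 = j) ∨ (l2 = i ∧ l3 = j) then 1 else 0 := by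
  simp only [linkSum_three ha _ _ _ _ _ (occ_P111 h h' a), crossKernel, Fin.val_inj]
  grind

variable [DecidableEq R]

lemma exists_linkSum_selfKernel_ne_zero_iff [Nontrivial R] {M : Model k α} (hM : M.valid τ)
    (ha : ε M.letter = 1) (hτ : M.letter ≠ τ M.letter → (1 : R) ≠ -1) (i j : Fin k) :
    (∃ v ≠ (0 : R), linkSum ε j (selfKernel i v) (occ 0 (desing M.toPhrase)) ≠ 0) ↔
      M.SelfLinks i j := by
  rcases M with ⟨l1, l2, a⟩ | ⟨l, a⟩ | ⟨l1, l2, a⟩ | ⟨l1, l2, a⟩ | ⟨l1, l2, l3, a⟩ <;>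
    simp only [Model.valid, Model.letter] at hM ha hτ <;>
    simp only [Model.toPhrase, Model.SelfLinks]
  · simp +contextual [linkSum_two ha _ _ _ _ (occ_P11 hM a), selfKernel, eq_comm]
  · simp only [linkSum_three ha _ _ _ _ _ (occ_P3 l a), selfKernel, Fin.val_inj]
    constructor
    · rintro ⟨v, hv, h⟩
      grind
    · rintro ⟨rfl, rfl⟩
      refine ⟨1, one_ne_zero, ?_⟩
      have := (hτ hM).symm
      simp [this]
  · simp only [linkSum_three ha _ _ _ _ _ (occ_P21 hM a), selfKernel, Fin.val_inj]
    constructor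
    · rintro ⟨v, hv, h⟩
      grind
    · rintro ⟨rfl, rfl⟩
      exact ⟨1, one_ne_zero, by simp [hM.ne']⟩
  · simp only [linkSum_three ha _ _ _ _ _ (occ_P12 hM a), selfKernel, Fin.val_inj]
    constructor
    · rintro ⟨v, hv, h⟩
      grind
    · rintro ⟨rfl, rfl⟩
      exact ⟨-1, by simp, by simp [hM.ne]⟩
  · simp only [linkSum_three ha _ _ _ _ _ (occ_P111 hM.1 hM.2 a), selfKernel, Fin.val_inj]
    grind

theorem eq_of_eHomotopic [Nontrivial R] (hε : ∀ b, ε (τ b) = -ε b) {M N : Model k α}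
    (hM : M.valid τ) (hN : N.valid τ) (hMN : M.letter = N.letter) (ha : ε M.letter = 1)
    (hτ : M.letter ≠ τ M.letter → (1 : R) ≠ -1) (h : EHomotopic τ M.toPhrase N.toPhrase) :
    M = N := by
  have hself (i j : Fin k) : M.SelfLinks i j ↔ N.SelfLinks i j := by
    rw [← exists_linkSum_selfKernel_ne_zero_iff hM ha hτ,
      ← exists_linkSum_selfKernel_ne_zero_iff hN (hMN ▸ ha) (hMN ▸ hτ)]
    refine exists_congr fun v => and_congr_right fun hv => ?_
    rw [linkSum_homotopic hε _ _ h]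
    · intro c
      simp [selfKernel, hv.symm]
    · intro c c' w w' hc
      grind [selfKernel]
  have hcross (i j : Fin k) (hij : i ≠ j) :
      linkSum ε 0 (crossKernel i j) (occ 0 (desing M.toPhrase)) =
        linkSum ε 0 (crossKernel i j) (occ 0 (desing N.toPhrase)) := by
    refine linkSum_homotopic hε (fun c => ?_) (fun _ _ _ _ _ => rfl) h
    have := Fin.val_ne_of_ne hij
    grind [crossKernel]
  have h01 : (0 : R) ≠ 1 := zero_ne_one
  rcases M with ⟨l1, l2, a⟩ | ⟨l, a⟩ | ⟨l1, l2, a⟩ | ⟨l1, l2, a⟩ | ⟨l1, l2, l3, a⟩ <;>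
    rcases N with ⟨m1, m2, b⟩ | ⟨m, b⟩ | ⟨m1, m2, b⟩ | ⟨m1, m2, b⟩ | ⟨m1, m2, m3, b⟩ <;>
    simp only [Model.valid, Model.letter] at hM hN hMN ha hτ <;>
    subst hMN <;>
    simp only [Model.toPhrase, Model.SelfLinks] at hself hcross
  case m11.m11 =>
    have h12 := hcross l1 l2 hM.ne
    rw [linkSum_crossKernel_m11 hM ha, linkSum_crossKernel_m11 hN ha] at h12
    grind
  case m11.m111 =>
    have h12 := hcross m1 m2 hN.1.ne
    have h23 := hcross m2 m3 hN.2.ne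
    rw [linkSum_crossKernel_m11 hM ha, linkSum_crossKernel_m111 hN.1 hN.2 ha] at h12 h23
    grind
  case m111.m11 =>
    have h12 := hcross l1 l2 hM.1.ne
    have h23 := hcross l2 l3 hM.2.ne
    rw [linkSum_crossKernel_m11 hN ha, linkSum_crossKernel_m111 hM.1 hM.2 ha] at h12 h23
    grind
  case m111.m111 =>
    have h12 := hcross l1 l2 hM.1.ne
    have h23 := hcross l2 l3 hM.2.ne
    rw [linkSum_crossKernel_m111 hM.1 hM.2 ha, linkSum_crossKernel_m111 hN.1 hN.2 ha] at h12 h23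
    grind
  all_goals clear hcross
  case m11.m3 | m111.m3 => have := hself m m; grind
  case m11.m21 | m111.m21 => have := hself m1 m2; grind
  case m11.m12 | m111.m12 => have := hself m2 m1; grind
  all_goals first
    | (have := hself l l; grind)
    | (have := hself l1 l2; grind)
    | (have := hself l2 l1; grind)

end Distinguish

/-- **Lemma 4.7** of the paper: for a fixed `a ∈ α`, two étale phrases
`P^{X₁;Y₁}_a` and `P^{X₂;Y₂}_a` (with admissible types and indices) are
homotopic if and only if `(X₁;Y₁) = (X₂;Y₂)`, that is, they have the same type
and the same indices. -/
theorem model_phrases_same_letter_homotopic_iff_equal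
    {α : Type*} [Fintype α] [DecidableEq α] (τ : α → α) (hτ : Function.Involutive τ)
    (k : ℕ) (a : α) (M N : Model k α) (hM : M.valid τ) (hN : N.valid τ)
    (hMa : M.letter = a) (hNa : N.letter = a) :
    EHomotopic τ M.toPhrase N.toPhrase ↔ M = N := by
  subst hMa
  refine ⟨fun h => ?_, fun h => h ▸ Relation.ReflTransGen.refl⟩
  by_cases ha : M.letter = τ M.letter
  · refine eq_of_eHomotopic (R := ZMod 2) (ε := fun b => if b = M.letter then 1 else 0)
      (fun b => ?_) hM hN hNa.symm (by simp) (fun h => absurd ha h) h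
    have hb : τ b = M.letter ↔ b = M.letter := by rw [hτ.eq_iff, ← ha]
    by_cases hbM : b = M.letter
    · simp only [if_pos (hb.mpr hbM), if_pos hbM]
      decide
    · simp [hb, hbM]
  · refine eq_of_eHomotopic (R := ℤ)
      (ε := fun b => if b = M.letter then 1 else if b = τ M.letter then -1 else 0)
      (fun b => ?_) hM hN hNa.symm (by simp) (fun _ => by decide) h
    simp only [hτ.eq_iff, hτ M.letter]
    grind

end Nano
end

section
/- For any a ∈ α, the étale phrases P^{2,1;l₁,l₂}_a and P^{2,1;m₁,m₂}_a (l₁ < l₂, m₁ < m₂ in {1,…,k}) are homotopic if and only if (l₁,l₂) = (m₁,m₂). -/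
namespace Nano

variable {α : Type*}

/-! ### Tagged words

A phrase is encoded by the list of its letters, each tagged with the index of its component. -/

/-- The letters of a flattened phrase tagged with component indices, starting from `n`. -/
def tag {γ : Type*} : ℕ → List (Option γ) → List (γ × ℕ)
  | _, [] => []
  | n, none :: l => tag (n + 1) l
  | n, some A :: l => (A, n) :: tag n l

/-- The letters of a phrase tagged with component indices, starting from `n`. -/
def tagPhrase {γ : Type*} : ℕ → List (List γ) → List (γ × ℕ)
  | _, [] => []
  | n, w :: P => w.map (fun A => (A, n)) ++ tagPhrase (n + 1) P

section Tag

variable {γ : Type*}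

theorem exists_tag_append (x : List (Option γ)) (n : ℕ) :
    ∃ m, n ≤ m ∧ ∀ y, tag n (x ++ y) = tag n x ++ tag m y := by
  induction x generalizing n with
  | nil => exact ⟨n, le_rfl, fun y => rfl⟩
  | cons o x ih =>
    cases o with
    | none =>
      obtain ⟨m, hm, h⟩ := ih (n + 1)
      exact ⟨m, by omega, fun y => h y⟩
    | some A =>
      obtain ⟨m, hm, h⟩ := ih n
      exact ⟨m, hm, fun y => by simp [tag, h y]⟩

theorem tag_map_some_append (w : List γ) (y : List (Option γ)) (n : ℕ) :
    tag n (w.map some ++ y) = w.map (fun A => (A, n)) ++ tag n y := by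
  induction w with
  | nil => rfl
  | cons A w ih => simp [tag, ih]

theorem tag_flat (P : Phrase α) (n : ℕ) : tag n (flat P) = tagPhrase n P := by
  induction P generalizing n with
  | nil => rfl
  | cons w P ih =>
    cases P with
    | nil =>
      have := tag_map_some_append w [] n
      simpa [flat, List.intercalate, tagPhrase, tag] using this
    | cons v P =>
      have h : flat (w :: v :: P) = w.map some ++ none :: flat (v :: P) := by
        simp [flat, List.intercalate]
      rw [h, tag_map_some_append, tagPhrase, ← ih, tag]

theorem map_fst_tagPhrase (P : List (List γ)) (n : ℕ) :
    (tagPhrase n P).map Prod.fst = P.flatten := by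
  induction P generalizing n with
  | nil => rfl
  | cons w P ih => simp [tagPhrase, ih, Function.comp_def]

theorem tagPhrase_map {δ : Type*} (g : γ → δ) (P : List (List γ)) (n : ℕ) :
    tagPhrase n (P.map (List.map g)) = (tagPhrase n P).map (Prod.map g id) := by
  induction P generalizing n with
  | nil => rfl
  | cons w P ih => simp [tagPhrase, ih, Function.comp_def]

theorem tagPhrase_replicate_append (m n : ℕ) (P : List (List γ)) :
    tagPhrase n (List.replicate m [] ++ P) = tagPhrase (n + m) P := by
  induction m generalizing n with
  | zero => rfl
  | succ m ih => simp [List.replicate_succ, tagPhrase, ih, Nat.add_assoc, Nat.add_comm 1]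

theorem ne_fst_of_mem {A : γ} {W : List (γ × ℕ)} (h : A ∉ W.map Prod.fst) {Y : γ × ℕ}
    (hY : Y ∈ W) : Y.1 ≠ A :=
  fun e => h (e ▸ List.mem_map_of_mem hY)

end Tag

/-! ### The invariant -/

section Invariant

variable {γ : Type*} [DecidableEq γ]

/-- The parity of the number of pairs of equal letters of component `i`, the first in `u`
and the second in `r`. -/
def pairing (i : ℕ) (u r : List (γ × ℕ)) : ZMod 2 :=
  (u.map fun X => if X.2 = i then (r.count X : ZMod 2) else 0).sum

/-- The sum, over the letters `Y` of `a`, of `c Y` times the pairing of what precedes `Y`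
with what follows `Y` in `u ++ a ++ r`. -/
def splitSum (i : ℕ) (c : γ × ℕ → ZMod 2) :
    List (γ × ℕ) → List (γ × ℕ) → List (γ × ℕ) → ZMod 2
  | _, [], _ => 0
  | u, Y :: a, r => c Y * pairing i u (a ++ r) + splitSum i c (u ++ [Y]) a r

/-- The weight of a letter: whether it lies in component `i` and also occurs in component `j`. -/
def weight (i j : ℕ) (W : List (γ × ℕ)) (Y : γ × ℕ) : ZMod 2 :=
  if Y.2 = i then (W.count (Y.1, j) : ZMod 2) else 0

/-- The parity of the number of pairs of letters `X`, `Y` such that `X Y X` is a subword of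
component `i` and `Y` also occurs in component `j`. -/
def crossing (i j : ℕ) (W : List (γ × ℕ)) : ZMod 2 :=
  splitSum i (weight i j W) [] W []

variable {i j : ℕ}

@[simp] theorem pairing_nil_left (r : List (γ × ℕ)) : pairing i [] r = 0 := rfl

@[simp] theorem pairing_nil_right (u : List (γ × ℕ)) : pairing i u [] = 0 := by
  simp [pairing]

theorem pairing_append_left (u v r : List (γ × ℕ)) :
    pairing i (u ++ v) r = pairing i u r + pairing i v r := by
  simp [pairing]

theorem pairing_append_right (u r s : List (γ × ℕ)) :
    pairing i u (r ++ s) = pairing i u r + pairing i u s := by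
  induction u with
  | nil => simp
  | cons X u ih =>
    simp only [pairing, List.map_cons, List.sum_cons] at ih ⊢
    rw [ih]
    split_ifs
    · rw [List.count_append, Nat.cast_add]
      ring
    · ring

theorem pairing_cons_cons_left (X Y : γ × ℕ) (u r : List (γ × ℕ)) :
    pairing i (X :: Y :: u) r = pairing i [X] r + pairing i (Y :: u) r :=
  pairing_append_left [X] (Y :: u) r

theorem pairing_cons_cons_right (u : List (γ × ℕ)) (X Y : γ × ℕ) (r : List (γ × ℕ)) :
    pairing i u (X :: Y :: r) = pairing i u [X] + pairing i u (Y :: r) :=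
  pairing_append_right u [X] (Y :: r)

theorem pairing_singleton_left_eq_zero {A : γ} {p : ℕ} {r : List (γ × ℕ)}
    (h : A ∉ r.map Prod.fst) : pairing i [(A, p)] r = 0 := by
  have : r.count (A, p) = 0 :=
    List.count_eq_zero.2 fun hm => h (List.mem_map_of_mem (f := Prod.fst) hm)
  simp [pairing, this]

theorem pairing_singleton_right_eq_zero {A : γ} {p : ℕ} {u : List (γ × ℕ)}
    (h : A ∉ u.map Prod.fst) : pairing i u [(A, p)] = 0 := by
  induction u with
  | nil => rfl
  | cons X u ih =>
    rw [List.map_cons, List.mem_cons, not_or] at h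
    have hX : X ≠ (A, p) := fun hX => h.1 (by rw [hX])
    have h0 : pairing i [X] [(A, p)] = 0 := by
      simp [pairing, hX.symm]
    have := pairing_append_left (i := i) [X] u [(A, p)]
    rw [List.singleton_append] at this
    rw [this, h0, ih h.2, add_zero]

theorem pairing_singletons (A B : γ) (p q : ℕ) :
    pairing i [(A, p)] [(B, q)] = if A = B ∧ p = i ∧ q = i then 1 else 0 := by
  by_cases hp : p = i
  · by_cases hq : q = i
    · by_cases hA : A = B
      · simp [pairing, hp, hq, hA]
      · have hB : B ≠ A := fun h => hA h.symm
        simp [pairing, hp, hq, hA, hB]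
    · have hq2 : q ≠ p := fun h => hq (h.trans hp)
      have : (B, q) ≠ (A, p) := fun h => hq2 (congrArg Prod.snd h)
      simp [pairing, hq, this]
  · simp [pairing, hp]

theorem splitSum_append (c : γ × ℕ → ZMod 2) (u a b r : List (γ × ℕ)) :
    splitSum i c u (a ++ b) r = splitSum i c u a (b ++ r) + splitSum i c (u ++ a) b r := by
  induction a generalizing u with
  | nil => simp [splitSum]
  | cons Y a ih => simp [splitSum, ih, add_assoc]

theorem splitSum_congr {c d : γ × ℕ → ZMod 2} {u v a r s : List (γ × ℕ)}
    (hc : ∀ Y ∈ a, c Y = d Y)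
    (hl : ∀ Y ∈ a, pairing i u [Y] = pairing i v [Y])
    (hr : ∀ Y ∈ a, pairing i [Y] r = pairing i [Y] s)
    (h : pairing i u r = pairing i v s) :
    splitSum i c u a r = splitSum i d v a s := by
  induction a generalizing u v with
  | nil => rfl
  | cons Y a ih =>
    have hua : ∀ b : List (γ × ℕ), (∀ Z ∈ b, pairing i u [Z] = pairing i v [Z]) →
        pairing i u b = pairing i v b := by
      intro b hb
      induction b with
      | nil => simp
      | cons Z b ihb =>
        rw [← List.singleton_append, pairing_append_right, pairing_append_right,
          hb Z (by simp), ihb fun T hT => hb T (by simp [hT])]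
    simp only [List.forall_mem_cons] at hc hl hr
    rw [splitSum, splitSum, hc.1, pairing_append_right, pairing_append_right,
      hua a hl.2, h]
    congr 1
    refine ih hc.2 (fun Z hZ => ?_) hr.2 ?_
    · rw [pairing_append_left, pairing_append_left, hl.2 Z hZ]
    · rw [pairing_append_left, pairing_append_left, h, hr.1]

theorem crossing_map {δ : Type*} [DecidableEq δ] {g : γ → δ} (hg : Function.Injective g)
    (W : List (γ × ℕ)) : crossing i j (W.map (Prod.map g id)) = crossing i j W := by
  have hG : Function.Injective (Prod.map g (id : ℕ → ℕ)) := hg.prodMap Function.injective_id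
  have hp (u r : List (γ × ℕ)) :
      pairing i (u.map (Prod.map g id)) (r.map (Prod.map g id)) = pairing i u r := by
    simp only [pairing, List.map_map, Function.comp_def, List.count_map_of_injective _ _ hG,
      Prod.map_snd, id]
  have hw (Y : γ × ℕ) :
      weight i j (W.map (Prod.map g id)) (Prod.map g id Y) = weight i j W Y := by
    have := List.count_map_of_injective W _ hG (Y.1, j)
    simp only [Prod.map_apply, id] at this
    simp only [weight, Prod.map_snd, Prod.map_fst, id, this]
  have hs (a u r : List (γ × ℕ)) :
      splitSum i (weight i j (W.map (Prod.map g id))) (u.map (Prod.map g id))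
        (a.map (Prod.map g id)) (r.map (Prod.map g id)) =
      splitSum i (weight i j W) u a r := by
    induction a generalizing u with
    | nil => rfl
    | cons Y a ih =>
      have := ih (u ++ [Y])
      simp only [List.map_append, List.map_cons, List.map_nil] at this
      simp only [List.map_cons, splitSum, hw, this, ← List.map_append, hp]
  exact hs W [] []

/-- Every letter occurring in a tagged word occurs exactly twice. -/
def IsGaussTagged (W : List (γ × ℕ)) : Prop :=
  ∀ A ∈ W.map Prod.fst, (W.map Prod.fst).count A = 2

theorem weight_append (U V : List (γ × ℕ)) (Y : γ × ℕ) :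
    weight i j (U ++ V) Y = weight i j U Y + weight i j V Y := by
  unfold weight
  split_ifs <;> simp

theorem weight_cons_cons (X Z : γ × ℕ) (W : List (γ × ℕ)) (Y : γ × ℕ) :
    weight i j (X :: Z :: W) Y = weight i j [X] Y + weight i j (Z :: W) Y :=
  weight_append [X] (Z :: W) Y

theorem weight_singleton_of_ne {A : γ} {p : ℕ} {Y : γ × ℕ} (h : Y.1 ≠ A) :
    weight i j [(A, p)] Y = 0 := by
  have : (A, p) ≠ (Y.1, j) := fun e => h (congrArg Prod.fst e).symm
  simp [weight, this]

theorem weight_singleton (A B : γ) (p q : ℕ) :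
    weight i j [(A, p)] (B, q) = if A = B ∧ p = j ∧ q = i then 1 else 0 := by
  by_cases hq : q = i <;> simp [weight, hq, List.count_singleton]

theorem weight_eq_zero {A : γ} {p : ℕ} {W : List (γ × ℕ)} (h : A ∉ W.map Prod.fst) :
    weight i j W (A, p) = 0 := by
  have : W.count (A, j) = 0 :=
    List.count_eq_zero.2 fun hm => h (List.mem_map_of_mem (f := Prod.fst) hm)
  simp [weight, this]

theorem pairing_singletons_of_ne_left {A : γ} {p : ℕ} {Y : γ × ℕ} (h : Y.1 ≠ A) :
    pairing i [(A, p)] [Y] = 0 :=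
  pairing_singleton_left_eq_zero (by simpa using h.symm)

theorem pairing_singletons_of_ne_right {A : γ} {p : ℕ} {Y : γ × ℕ} (h : Y.1 ≠ A) :
    pairing i [Y] [(A, p)] = 0 :=
  pairing_singleton_right_eq_zero (by simpa using h.symm)

/-- The first homotopy move preserves `crossing`. -/
theorem crossing_h1 {A : γ} {p : ℕ} {x y : List (γ × ℕ)}
    (h : IsGaussTagged (x ++ [(A, p), (A, p)] ++ y)) :
    crossing i j (x ++ [(A, p), (A, p)] ++ y) = crossing i j (x ++ y) := by
  have hA := h A (by simp)
  simp only [List.map_append, List.map_cons, List.map_nil, List.count_append,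
    List.count_cons, List.count_nil, beq_self_eq_true, if_true] at hA
  have hx : A ∉ x.map Prod.fst := List.count_eq_zero.1 (by omega)
  have hy : A ∉ y.map Prod.fst := List.count_eq_zero.1 (by omega)
  have hw (Y : γ × ℕ) (hY : Y.1 ≠ A) :
      weight i j (x ++ [(A, p), (A, p)] ++ y) Y = weight i j (x ++ y) Y := by
    simp only [weight_append, weight_cons_cons, weight_singleton_of_ne hY, add_zero]
  have hwA : weight i j (x ++ [(A, p), (A, p)] ++ y) (A, p) = 0 := by
    simp only [weight_append, weight_cons_cons, weight_eq_zero hx, weight_eq_zero hy,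
      weight_singleton]
    grind
  simp only [crossing, splitSum_append, List.nil_append, List.append_nil]
  have e : splitSum i (weight i j (x ++ [(A, p), (A, p)] ++ y)) x [(A, p), (A, p)] y = 0 := by
    simp only [splitSum, hwA, zero_mul, add_zero]
  rw [e, add_zero]
  congr 1
  · refine splitSum_congr (fun Y hY => hw Y (ne_fst_of_mem hx hY)) (fun _ _ => rfl)
      (fun Y hY => ?_) rfl
    simp only [pairing_append_right, pairing_cons_cons_right,
      pairing_singletons_of_ne_right (ne_fst_of_mem hx hY), zero_add]
  · refine splitSum_congr (fun Y hY => hw Y (ne_fst_of_mem hy hY)) (fun Y hY => ?_)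
      (fun _ _ => rfl) (by simp)
    simp only [pairing_append_left, pairing_cons_cons_left,
      pairing_singletons_of_ne_left (ne_fst_of_mem hy hY), add_zero]

set_option linter.unusedSimpArgs false in
/-- The second homotopy move preserves `crossing`, for any projections of its letters. -/
theorem crossing_h2 {A B : γ} {p q : ℕ} {x y z : List (γ × ℕ)}
    (h : IsGaussTagged (x ++ [(A, p), (B, p)] ++ y ++ [(B, q), (A, q)] ++ z)) :
    crossing i j (x ++ [(A, p), (B, p)] ++ y ++ [(B, q), (A, q)] ++ z) =
      crossing i j (x ++ y ++ z) := by
  have hA := h A (by simp)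
  have hB := h B (by simp)
  have hAB : A ≠ B := by
    rintro rfl
    simp only [List.map_append, List.map_cons, List.map_nil, List.count_append,
      List.count_cons, List.count_nil, beq_self_eq_true, if_true] at hA
    omega
  simp only [List.map_append, List.map_cons, List.map_nil, List.count_append,
    List.count_cons, List.count_nil, beq_self_eq_true, if_true, beq_iff_eq, hAB, hAB.symm,
    if_false] at hA hB
  have hxA : A ∉ x.map Prod.fst := List.count_eq_zero.1 (by omega)
  have hyA : A ∉ y.map Prod.fst := List.count_eq_zero.1 (by omega)
  have hzA : A ∉ z.map Prod.fst := List.count_eq_zero.1 (by omega)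
  have hxB : B ∉ x.map Prod.fst := List.count_eq_zero.1 (by omega)
  have hyB : B ∉ y.map Prod.fst := List.count_eq_zero.1 (by omega)
  have hzB : B ∉ z.map Prod.fst := List.count_eq_zero.1 (by omega)
  set W := x ++ [(A, p), (B, p)] ++ y ++ [(B, q), (A, q)] ++ z with hW
  have hw (Y : γ × ℕ) (hYA : Y.1 ≠ A) (hYB : Y.1 ≠ B) :
      weight i j W Y = weight i j (x ++ y ++ z) Y := by
    simp only [hW, weight_append, weight_cons_cons, weight_singleton_of_ne hYA,
      weight_singleton_of_ne hYB, add_zero]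
  have hwA (s : ℕ) : weight i j W (A, s) =
      (if p = j ∧ s = i then 1 else 0) + (if q = j ∧ s = i then 1 else 0) := by
    simp only [hW, weight_append, weight_cons_cons, weight_eq_zero hxA, weight_eq_zero hyA,
      weight_eq_zero hzA, weight_singleton, hAB.symm, true_and, false_and, if_false, zero_add,
      add_zero]
  have hwB (s : ℕ) : weight i j W (B, s) =
      (if p = j ∧ s = i then 1 else 0) + (if q = j ∧ s = i then 1 else 0) := by
    simp only [hW, weight_append, weight_cons_cons, weight_eq_zero hxB, weight_eq_zero hyB,
      weight_eq_zero hzB, weight_singleton, hAB, true_and, false_and, if_false, zero_add,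
      add_zero]
  unfold crossing
  generalize weight i j W = c at hw hwA hwB ⊢
  simp only [hW, splitSum_append, List.nil_append, List.append_nil]
  have ex : splitSum i c [] x ([(A, p), (B, p)] ++ (y ++ ([(B, q), (A, q)] ++ z))) =
      splitSum i (weight i j (x ++ y ++ z)) [] x (y ++ z) := by
    refine splitSum_congr
      (fun Y hY => hw Y (ne_fst_of_mem hxA hY) (ne_fst_of_mem hxB hY))
      (fun _ _ => rfl) (fun Y hY => ?_) ?_
    · simp only [zero_add, add_zero, ne_eq, not_false_eq_true, pairing_append_right,
        pairing_cons_cons_right, pairing_singletons_of_ne_right,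
        ne_fst_of_mem hxA hY, ne_fst_of_mem hxB hY]
    · simp only [zero_add, add_zero, pairing_nil_left, pairing_nil_right, not_false_eq_true,
        pairing_append_left, pairing_append_right, pairing_cons_cons_left,
        pairing_cons_cons_right, pairing_singletons, pairing_singleton_left_eq_zero,
        pairing_singleton_right_eq_zero,
        hxA, hxB, hyA, hyB, hzA, hzB]
  have ey : splitSum i c (x ++ [(A, p), (B, p)]) y ([(B, q), (A, q)] ++ z) =
      splitSum i (weight i j (x ++ y ++ z)) x y z := by
    refine splitSum_congr
      (fun Y hY => hw Y (ne_fst_of_mem hyA hY) (ne_fst_of_mem hyB hY))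
      (fun Y hY => ?_) (fun Y hY => ?_) ?_
    · simp only [zero_add, add_zero, ne_eq, not_false_eq_true, pairing_append_left,
        pairing_cons_cons_left, pairing_singletons_of_ne_left,
        ne_fst_of_mem hyA hY, ne_fst_of_mem hyB hY]
    · simp only [zero_add, add_zero, ne_eq, not_false_eq_true, pairing_append_right,
        pairing_cons_cons_right, pairing_singletons_of_ne_right,
        ne_fst_of_mem hyA hY, ne_fst_of_mem hyB hY]
    · simp only [zero_add, add_zero, pairing_nil_left, pairing_nil_right, not_false_eq_true,
        pairing_append_left, pairing_append_right, pairing_cons_cons_left,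
        pairing_cons_cons_right, pairing_singletons, pairing_singleton_left_eq_zero,
        pairing_singleton_right_eq_zero,
        hxA, hxB, hyA, hyB, hzA, hzB]
      grind
  have ez : splitSum i c (x ++ [(A, p), (B, p)] ++ y ++ [(B, q), (A, q)]) z [] =
      splitSum i (weight i j (x ++ y ++ z)) (x ++ y) z [] := by
    refine splitSum_congr
      (fun Y hY => hw Y (ne_fst_of_mem hzA hY) (ne_fst_of_mem hzB hY))
      (fun Y hY => ?_) (fun _ _ => rfl) ?_
    · simp only [zero_add, add_zero, ne_eq, not_false_eq_true, pairing_append_left,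
        pairing_cons_cons_left, pairing_singletons_of_ne_left,
        ne_fst_of_mem hzA hY, ne_fst_of_mem hzB hY]
    · simp only [zero_add, add_zero, pairing_nil_left, pairing_nil_right, not_false_eq_true,
        pairing_append_left, pairing_append_right, pairing_cons_cons_left,
        pairing_cons_cons_right, pairing_singletons, pairing_singleton_left_eq_zero,
        pairing_singleton_right_eq_zero,
        hxA, hxB, hyA, hyB, hzA, hzB]
  have e : splitSum i c x [(A, p), (B, p)] (y ++ ([(B, q), (A, q)] ++ z)) +
      splitSum i c (x ++ [(A, p), (B, p)] ++ y) [(B, q), (A, q)] z = 0 := by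
    simp only [splitSum, hwA, hwB, List.nil_append]
    simp only [zero_add, add_zero, true_and, false_and, if_false, not_false_eq_true,
        pairing_append_left, pairing_append_right, pairing_cons_cons_left,
        pairing_cons_cons_right, pairing_singletons, pairing_singleton_left_eq_zero,
        pairing_singleton_right_eq_zero,
        hxA, hxB, hyA, hyB, hzA, hzB,
        hAB, hAB.symm]
    grind
  linear_combination ex + ey + ez + e

set_option linter.unusedSimpArgs false in
/-- The third homotopy move preserves `crossing`, for any projections of its letters. -/
theorem crossing_h3 {A B C : γ} {p q r : ℕ} (hpq : p ≤ q) (hqr : q ≤ r)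
    {x y z t : List (γ × ℕ)}
    (h : IsGaussTagged (x ++ [(A, p), (B, p)] ++ y ++ [(A, q), (C, q)] ++ z ++
      [(B, r), (C, r)] ++ t)) :
    crossing i j (x ++ [(A, p), (B, p)] ++ y ++ [(A, q), (C, q)] ++ z ++ [(B, r), (C, r)] ++ t) =
      crossing i j (x ++ [(B, p), (A, p)] ++ y ++ [(C, q), (A, q)] ++ z ++
        [(C, r), (B, r)] ++ t) := by
  have hA := h A (by simp)
  have hB := h B (by simp)
  have hC := h C (by simp)
  simp only [List.map_append, List.map_cons, List.map_nil, List.count_append,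
    List.count_cons, List.count_nil, beq_self_eq_true, if_true, beq_iff_eq] at hA hB hC
  have hAB : A ≠ B := by
    rintro rfl
    simp only [if_true] at hA
    omega
  have hAC : A ≠ C := by
    rintro rfl
    simp only [if_true] at hA
    omega
  have hBC : B ≠ C := by
    rintro rfl
    simp only [if_true] at hB
    omega
  simp only [hAB, hAB.symm, hAC, hAC.symm, hBC, hBC.symm, if_false] at hA hB hC
  have hxA : A ∉ x.map Prod.fst := List.count_eq_zero.1 (by omega)
  have hxB : B ∉ x.map Prod.fst := List.count_eq_zero.1 (by omega)
  have hxC : C ∉ x.map Prod.fst := List.count_eq_zero.1 (by omega)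
  have hyA : A ∉ y.map Prod.fst := List.count_eq_zero.1 (by omega)
  have hyB : B ∉ y.map Prod.fst := List.count_eq_zero.1 (by omega)
  have hyC : C ∉ y.map Prod.fst := List.count_eq_zero.1 (by omega)
  have hzA : A ∉ z.map Prod.fst := List.count_eq_zero.1 (by omega)
  have hzB : B ∉ z.map Prod.fst := List.count_eq_zero.1 (by omega)
  have hzC : C ∉ z.map Prod.fst := List.count_eq_zero.1 (by omega)
  have htA : A ∉ t.map Prod.fst := List.count_eq_zero.1 (by omega)
  have htB : B ∉ t.map Prod.fst := List.count_eq_zero.1 (by omega)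
  have htC : C ∉ t.map Prod.fst := List.count_eq_zero.1 (by omega)
  set W := x ++ [(A, p), (B, p)] ++ y ++ [(A, q), (C, q)] ++ z ++ [(B, r), (C, r)] ++ t with hW
  set V := x ++ [(B, p), (A, p)] ++ y ++ [(C, q), (A, q)] ++ z ++ [(C, r), (B, r)] ++ t with hV
  have hw (Y : γ × ℕ) (hYA : Y.1 ≠ A) (hYB : Y.1 ≠ B) (hYC : Y.1 ≠ C) :
      weight i j W Y = weight i j V Y := by
    simp only [hW, hV, weight_append, weight_cons_cons, weight_singleton_of_ne hYA,
      weight_singleton_of_ne hYB, weight_singleton_of_ne hYC, add_zero]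
  have hwA (s : ℕ) : weight i j W (A, s) =
      (if p = j ∧ s = i then 1 else 0) + (if q = j ∧ s = i then 1 else 0) := by
    simp only [hW, weight_append, weight_cons_cons, weight_eq_zero hxA, weight_eq_zero hyA,
      weight_eq_zero hzA, weight_eq_zero htA, weight_singleton, hAB, hAB.symm, hAC, hAC.symm,
      hBC, hBC.symm, true_and, false_and, if_false, zero_add, add_zero]
  have hwB (s : ℕ) : weight i j W (B, s) =
      (if p = j ∧ s = i then 1 else 0) + (if r = j ∧ s = i then 1 else 0) := by
    simp only [hW, weight_append, weight_cons_cons, weight_eq_zero hxB, weight_eq_zero hyB,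
      weight_eq_zero hzB, weight_eq_zero htB, weight_singleton, hAB, hAB.symm, hAC, hAC.symm,
      hBC, hBC.symm, true_and, false_and, if_false, zero_add, add_zero]
  have hwC (s : ℕ) : weight i j W (C, s) =
      (if q = j ∧ s = i then 1 else 0) + (if r = j ∧ s = i then 1 else 0) := by
    simp only [hW, weight_append, weight_cons_cons, weight_eq_zero hxC, weight_eq_zero hyC,
      weight_eq_zero hzC, weight_eq_zero htC, weight_singleton, hAB, hAB.symm, hAC, hAC.symm,
      hBC, hBC.symm, true_and, false_and, if_false, zero_add, add_zero]
  have hwA' (s : ℕ) : weight i j V (A, s) =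
      (if p = j ∧ s = i then 1 else 0) + (if q = j ∧ s = i then 1 else 0) := by
    simp only [hV, weight_append, weight_cons_cons, weight_eq_zero hxA, weight_eq_zero hyA,
      weight_eq_zero hzA, weight_eq_zero htA, weight_singleton, hAB, hAB.symm, hAC, hAC.symm,
      hBC, hBC.symm, true_and, false_and, if_false, zero_add, add_zero]
  have hwB' (s : ℕ) : weight i j V (B, s) =
      (if p = j ∧ s = i then 1 else 0) + (if r = j ∧ s = i then 1 else 0) := by
    simp only [hV, weight_append, weight_cons_cons, weight_eq_zero hxB, weight_eq_zero hyB,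
      weight_eq_zero hzB, weight_eq_zero htB, weight_singleton, hAB, hAB.symm, hAC, hAC.symm,
      hBC, hBC.symm, true_and, false_and, if_false, zero_add, add_zero]
  have hwC' (s : ℕ) : weight i j V (C, s) =
      (if q = j ∧ s = i then 1 else 0) + (if r = j ∧ s = i then 1 else 0) := by
    simp only [hV, weight_append, weight_cons_cons, weight_eq_zero hxC, weight_eq_zero hyC,
      weight_eq_zero hzC, weight_eq_zero htC, weight_singleton, hAB, hAB.symm, hAC, hAC.symm,
      hBC, hBC.symm, true_and, false_and, if_false, zero_add, add_zero]
  unfold crossing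
  generalize weight i j W = c at hw hwA hwB hwC ⊢
  generalize weight i j V = d at hw hwA' hwB' hwC' ⊢
  simp only [hW, hV, splitSum_append, List.nil_append, List.append_nil]
  have ex : splitSum i c [] x ([(A, p), (B, p)] ++ (y ++ ([(A, q), (C, q)] ++ (z ++
    ([(B, r), (C, r)] ++ t))))) =
      splitSum i d [] x ([(B, p), (A, p)] ++ (y ++ ([(C, q), (A, q)] ++ (z ++ ([(C, r), (B, r)] ++
        t))))) := by
    refine splitSum_congr
      (fun Y hY => hw Y (ne_fst_of_mem hxA hY) (ne_fst_of_mem hxB hY) (ne_fst_of_mem hxC hY))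
      (fun _ _ => rfl) (fun Y hY => ?_) ?_
    · simp only [zero_add, add_zero, ne_eq, not_false_eq_true, pairing_append_right,
        pairing_cons_cons_right, pairing_singletons_of_ne_right,
        ne_fst_of_mem hxA hY, ne_fst_of_mem hxB hY, ne_fst_of_mem hxC hY]
    · simp only [zero_add, add_zero, pairing_nil_left, pairing_nil_right, not_false_eq_true,
        pairing_append_left, pairing_append_right, pairing_cons_cons_left,
        pairing_cons_cons_right, pairing_singletons, pairing_singleton_left_eq_zero,
        pairing_singleton_right_eq_zero,
        hxA, hxB, hxC, hyA, hyB, hyC, hzA, hzB, hzC, htA, htB, htC]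
  have ey : splitSum i c (x ++ [(A, p), (B, p)]) y ([(A, q), (C, q)] ++ (z ++ ([(B, r), (C, r)] ++
    t))) =
      splitSum i d (x ++ [(B, p), (A, p)]) y ([(C, q), (A, q)] ++ (z ++ ([(C, r), (B, r)] ++
        t))) := by
    refine splitSum_congr
      (fun Y hY => hw Y (ne_fst_of_mem hyA hY) (ne_fst_of_mem hyB hY) (ne_fst_of_mem hyC hY))
      (fun Y hY => ?_) (fun Y hY => ?_) ?_
    · simp only [zero_add, add_zero, ne_eq, not_false_eq_true, pairing_append_left,
        pairing_cons_cons_left, pairing_singletons_of_ne_left,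
        ne_fst_of_mem hyA hY, ne_fst_of_mem hyB hY, ne_fst_of_mem hyC hY]
    · simp only [zero_add, add_zero, ne_eq, not_false_eq_true, pairing_append_right,
        pairing_cons_cons_right, pairing_singletons_of_ne_right,
        ne_fst_of_mem hyA hY, ne_fst_of_mem hyB hY, ne_fst_of_mem hyC hY]
    · simp only [zero_add, add_zero, pairing_nil_left, pairing_nil_right, not_false_eq_true,
        pairing_append_left, pairing_append_right, pairing_cons_cons_left,
        pairing_cons_cons_right, pairing_singletons, pairing_singleton_left_eq_zero,
        pairing_singleton_right_eq_zero,
        hxA, hxB, hxC, hyA, hyB, hyC, hzA, hzB, hzC, htA, htB, htC]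
      ring
  have ez : splitSum i c (x ++ [(A, p), (B, p)] ++ y ++ [(A, q), (C, q)]) z ([(B, r), (C, r)] ++
    t) =
      splitSum i d (x ++ [(B, p), (A, p)] ++ y ++ [(C, q), (A, q)]) z ([(C, r), (B, r)] ++ t) := by
    refine splitSum_congr
      (fun Y hY => hw Y (ne_fst_of_mem hzA hY) (ne_fst_of_mem hzB hY) (ne_fst_of_mem hzC hY))
      (fun Y hY => ?_) (fun Y hY => ?_) ?_
    · simp only [zero_add, add_zero, ne_eq, not_false_eq_true, pairing_append_left,
        pairing_cons_cons_left, pairing_singletons_of_ne_left,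
        ne_fst_of_mem hzA hY, ne_fst_of_mem hzB hY, ne_fst_of_mem hzC hY]
    · simp only [zero_add, add_zero, ne_eq, not_false_eq_true, pairing_append_right,
        pairing_cons_cons_right, pairing_singletons_of_ne_right,
        ne_fst_of_mem hzA hY, ne_fst_of_mem hzB hY, ne_fst_of_mem hzC hY]
    · simp only [zero_add, add_zero, pairing_nil_left, pairing_nil_right, not_false_eq_true,
        pairing_append_left, pairing_append_right, pairing_cons_cons_left,
        pairing_cons_cons_right, pairing_singletons, pairing_singleton_left_eq_zero,
        pairing_singleton_right_eq_zero,
        hxA, hxB, hxC, hyA, hyB, hyC, hzA, hzB, hzC, htA, htB, htC]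
      ring
  have et : splitSum i c (x ++ [(A, p), (B, p)] ++ y ++ [(A, q), (C, q)] ++ z ++
    [(B, r), (C, r)]) t [] =
      splitSum i d (x ++ [(B, p), (A, p)] ++ y ++ [(C, q), (A, q)] ++ z ++
        [(C, r), (B, r)]) t [] := by
    refine splitSum_congr
      (fun Y hY => hw Y (ne_fst_of_mem htA hY) (ne_fst_of_mem htB hY) (ne_fst_of_mem htC hY))
      (fun Y hY => ?_) (fun _ _ => rfl) ?_
    · simp only [zero_add, add_zero, ne_eq, not_false_eq_true, pairing_append_left,
        pairing_cons_cons_left, pairing_singletons_of_ne_left,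
        ne_fst_of_mem htA hY, ne_fst_of_mem htB hY, ne_fst_of_mem htC hY]
    · simp only [zero_add, add_zero, pairing_nil_left, pairing_nil_right, not_false_eq_true,
        pairing_append_left, pairing_append_right, pairing_cons_cons_left,
        pairing_cons_cons_right, pairing_singletons, pairing_singleton_left_eq_zero,
        pairing_singleton_right_eq_zero,
        hxA, hxB, hxC, hyA, hyB, hyC, hzA, hzB, hzC, htA, htB, htC]
  have e : splitSum i c x [(A, p), (B, p)]
        (y ++ ([(A, q), (C, q)] ++ (z ++ ([(B, r), (C, r)] ++ t)))) +
      splitSum i c (x ++ [(A, p), (B, p)] ++ y) [(A, q), (C, q)]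
        (z ++ ([(B, r), (C, r)] ++ t)) +
      splitSum i c (x ++ [(A, p), (B, p)] ++ y ++ [(A, q), (C, q)] ++ z) [(B, r), (C, r)]
        t =
      splitSum i d x [(B, p), (A, p)]
        (y ++ ([(C, q), (A, q)] ++ (z ++ ([(C, r), (B, r)] ++ t)))) +
      splitSum i d (x ++ [(B, p), (A, p)] ++ y) [(C, q), (A, q)]
        (z ++ ([(C, r), (B, r)] ++ t)) +
      splitSum i d (x ++ [(B, p), (A, p)] ++ y ++ [(C, q), (A, q)] ++ z) [(C, r), (B, r)]
        t := by
    simp only [splitSum, hwA, hwB, hwC, hwA', hwB', hwC', List.nil_append]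
    simp only [zero_add, add_zero, true_and, false_and, if_false, not_false_eq_true,
        pairing_append_left, pairing_append_right, pairing_cons_cons_left,
        pairing_cons_cons_right, pairing_singletons, pairing_singleton_left_eq_zero,
        pairing_singleton_right_eq_zero,
        hxA, hxB, hxC, hyA, hyB, hyC, hzA, hzB, hzC, htA, htB, htC,
        hAB, hAB.symm, hAC, hAC.symm, hBC, hBC.symm]
    grind
  linear_combination ex + ey + ez + et + e

end Invariant

/-! ### Homotopy invariance -/

theorem IsGauss.tagged [DecidableEq α] {P : Phrase α} (h : IsGauss P) :
    IsGaussTagged (tagPhrase 0 P) := by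
  unfold IsGaussTagged
  rw [map_fst_tagPhrase]
  intro A hA
  convert h A hA using 2
  exact lawful_beq_subsingleton _ _

theorem crossing_eq_of_move [DecidableEq α] {τ : α → α} {i j : ℕ}
    {P Q : Phrase α} (hPQ : Move τ P Q) (hP : IsGauss P) :
    crossing i j (tagPhrase 0 P) = crossing i j (tagPhrase 0 Q) := by
  have hG := hP.tagged
  cases hPQ with
  | iso f hf P =>
    have hr : rename f P = P.map (List.map (Prod.map f id)) := rfl
    rw [hr, tagPhrase_map, crossing_map (hf.prodMap Function.injective_id)]
  | h1 P Q A x y hfP hfQ =>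
    obtain ⟨p, -, hx⟩ := exists_tag_append x 0
    rw [← tag_flat, hfP, List.append_assoc, hx] at hG ⊢
    rw [← tag_flat, hfQ, hx]
    have := crossing_h1 (i := i) (j := j) (A := A) (p := p) (x := tag 0 x) (y := tag p y)
    simp only [List.append_assoc] at this
    exact this hG
  | h2 P Q A B x y z hAB hfP hfQ =>
    obtain ⟨p, -, hx⟩ := exists_tag_append x 0
    obtain ⟨q, -, hy⟩ := exists_tag_append y p
    have hP' : tagPhrase 0 P =
        tag 0 x ++ [(A, p), (B, p)] ++ tag p y ++ [(B, q), (A, q)] ++ tag q z := by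
      rw [← tag_flat, hfP]
      simp only [List.append_assoc, List.cons_append, List.nil_append, hx, hy, tag]
    have hQ' : tagPhrase 0 Q = tag 0 x ++ tag p y ++ tag q z := by
      rw [← tag_flat, hfQ]
      simp only [List.append_assoc, hx, hy]
    rw [hP'] at hG ⊢
    rw [hQ']
    exact crossing_h2 hG
  | h3 P Q A B C x y z t hAB hBC hfP hfQ =>
    obtain ⟨p, -, hx⟩ := exists_tag_append x 0
    obtain ⟨q, hpq, hy⟩ := exists_tag_append y p
    obtain ⟨r, hqr, hz⟩ := exists_tag_append z q
    have hP' : tagPhrase 0 P = tag 0 x ++ [(A, p), (B, p)] ++ tag p y ++ [(A, q), (C, q)] ++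
        tag q z ++ [(B, r), (C, r)] ++ tag r t := by
      rw [← tag_flat, hfP]
      simp only [List.append_assoc, List.cons_append, List.nil_append, hx, hy, hz, tag]
    have hQ' : tagPhrase 0 Q = tag 0 x ++ [(B, p), (A, p)] ++ tag p y ++ [(C, q), (A, q)] ++
        tag q z ++ [(C, r), (B, r)] ++ tag r t := by
      rw [← tag_flat, hfQ]
      simp only [List.append_assoc, List.cons_append, List.nil_append, hx, hy, hz, tag]
    rw [hP'] at hG ⊢
    rw [hQ']
    exact crossing_h3 hpq hqr hG

theorem Homotopic.crossing_eq [DecidableEq α] {τ : α → α} {i j : ℕ}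
    {P Q : Phrase α} (h : Homotopic τ P Q) :
    crossing i j (tagPhrase 0 P) = crossing i j (tagPhrase 0 Q) := by
  induction h with
  | refl => rfl
  | tail _ hstep ih =>
    obtain ⟨hm, hX, hY⟩ := hstep
    refine ih.trans ?_
    cases hm with
    | inl hm => exact crossing_eq_of_move hm hX.1
    | inr hm => exact (crossing_eq_of_move hm hY.1).symm

/-! ### The phrases `P^{2,1;l₁,l₂}_a` -/

theorem P21_eq {k : ℕ} (l1 l2 : Fin k) (hl : l1 < l2) (a : α) :
    P21 k l1 l2 a = List.replicate l1 [] ++ [ofα a, ofα a] ::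
      (List.replicate (l2 - l1 - 1) [] ++ [ofα a] :: List.replicate (k - l2 - 1) []) := by
  have h1 := l1.2
  have h2 := l2.2
  have hl' : (l1 : ℕ) < l2 := hl
  apply List.ext_getElem
  · simp [P21]
    omega
  · intro n hn hn'
    simp only [P21, List.getElem_ofFn, Fin.ext_iff, List.getElem_append, List.getElem_cons,
      List.length_replicate, List.getElem_replicate]
    grind

theorem desingAux_replicate_append [DecidableEq α] (m seen : Letter α → ℕ) (n : ℕ)
    (P : Phrase α) :
    desingAux m (List.replicate n [] ++ P) seen =
      List.replicate n [] ++ desingAux m P seen := by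
  induction n with
  | zero => rfl
  | succ n ih => simp [List.replicate_succ, desingAux, desingWord, ih]

theorem tagPhrase_desing_P21 [DecidableEq α] {k : ℕ} (l1 l2 : Fin k) (hl : l1 < l2) (a : α) :
    tagPhrase 0 (desing (P21 k l1 l2 a)) =
      [(dLetter (ofα a) 1 2, (l1 : ℕ)), (dLetter (ofα a) 1 3, (l1 : ℕ)),
        (dLetter (ofα a) 1 2, (l1 : ℕ)), (dLetter (ofα a) 2 3, (l1 : ℕ)),
        (dLetter (ofα a) 1 3, (l2 : ℕ)), (dLetter (ofα a) 2 3, (l2 : ℕ))] := by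
  have hl' : (l1 : ℕ) < l2 := hl
  have hn : (l1 : ℕ) + 1 + (l2 - l1 - 1) = l2 := by omega
  have hr (n : ℕ) (m seen : Letter α → ℕ) :
      desingAux m (List.replicate n []) seen = List.replicate n [] := by
    simpa [desingAux] using desingAux_replicate_append m seen n []
  have ht (n m : ℕ) : tagPhrase m (List.replicate n ([] : List (Letter α))) = [] := by
    simpa [tagPhrase] using tagPhrase_replicate_append n m ([] : List (List (Letter α)))
  have hc : (P21 k l1 l2 a).flatten.count (ofα a) = 3 := by
    rw [P21_eq l1 l2 hl]
    simp
  unfold desing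
  generalize hm : (fun A => (P21 k l1 l2 a).flatten.count A) = m
  have hm3 : m (ofα a) = 3 := by rw [← hm, ← hc]
  rw [P21_eq l1 l2 hl]
  simp only [desingAux_replicate_append, tagPhrase_replicate_append, desingAux, tagPhrase,
    desingWord, hr, ht, hm3, hn, zero_add]
  simp [repl, List.range_succ]

theorem crossing_desing_P21 [DecidableEq α] {k : ℕ} (l1 l2 : Fin k) (hl : l1 < l2) (a : α)
    {i j : ℕ} (hij : i ≠ j) :
    crossing i j (tagPhrase 0 (desing (P21 k l1 l2 a))) =
      if i = l1 ∧ j = l2 then 1 else 0 := by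
  have hl' : (l1 : ℕ) < l2 := hl
  rw [tagPhrase_desing_P21 l1 l2 hl]
  have h1 : dLetter (ofα a) 1 2 ≠ dLetter (ofα a) 1 3 := by simp [dLetter]
  have h2 : dLetter (ofα a) 1 2 ≠ dLetter (ofα a) 2 3 := by simp [dLetter]
  have h3 : dLetter (ofα a) 1 3 ≠ dLetter (ofα a) 2 3 := by simp [dLetter]
  generalize dLetter (ofα a) 1 2 = X at *
  generalize dLetter (ofα a) 1 3 = Y at *
  generalize dLetter (ofα a) 2 3 = Z at *
  generalize (l1 : ℕ) = p at *
  generalize (l2 : ℕ) = q at *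
  simp only [crossing, splitSum, List.nil_append, List.cons_append, pairing_cons_cons_left,
    pairing_cons_cons_right, pairing_nil_left, pairing_nil_right, pairing_singletons,
    weight_cons_cons, weight_singleton, h1, h2, h3, h1.symm, h2.symm, h3.symm, true_and,
    false_and, if_false, zero_add, add_zero]
  grind

/-- For any `a ∈ α`, the étale phrases `P^{2,1;l₁,l₂}_a` and `P^{2,1;m₁,m₂}_a`
(`l₁ < l₂`, `m₁ < m₂` in `{1,…,k}`) are homotopic if and only if
`(l₁,l₂) = (m₁,m₂)`. -/
theorem P21_homotopic_iff_eq
    {α : Type*} [Fintype α] [DecidableEq α] (τ : α → α) (hτ : Function.Involutive τ)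
    (k : ℕ) (a : α) (l1 l2 m1 m2 : Fin k) (hl : l1 < l2) (hm : m1 < m2) :
    EHomotopic τ (P21 k l1 l2 a) (P21 k m1 m2 a) ↔ l1 = m1 ∧ l2 = m2 := by
  constructor
  · intro h
    have hne : (l1 : ℕ) ≠ l2 := fun e => hl.ne (Fin.ext e)
    have := Homotopic.crossing_eq (i := l1) (j := l2) h
    rw [crossing_desing_P21 l1 l2 hl a hne, crossing_desing_P21 m1 m2 hm a hne,
      if_pos ⟨rfl, rfl⟩] at this
    by_contra hcon
    rw [if_neg fun e => hcon ⟨Fin.ext e.1, Fin.ext e.2⟩] at this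
    exact one_ne_zero this
  · rintro ⟨rfl, rfl⟩
    exact Relation.ReflTransGen.refl

end Nano
end
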